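/- Let R be a reduced noetherian complete local 𝔽_q-algebra with maximal ideal 𝔪. Let b ∈ GL_r(R((z))) be such that all coefficients of all entries of b − 1 lie in 𝔪 (b ≡ 1 mod 𝔪), and assume that for every minimal prime ideal 𝔭 of R there exists y ∈ GL_r(K_𝔭((z))) with b_𝔭·σ(y) = y. Then there exists x ∈ GL_r(R((z))) with b·σ(x) = x; equivalently b = x·σ(x)⁻¹, so b is σ-conjugate to the identity over R. -/

import Mathlib

noncomputable section

open scoped Classical

namespace HVpaper

variable {A : Type*} [CommRing A]

/-- Coefficientwise `q`-th power map on formal Laurent series (the map `σ` for `q ≠ 0`;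
junk value `0` for `q = 0`). -/
def laurentFrob (q : ℕ) (x : LaurentSeries A) : LaurentSeries A :=
  if hq : q = 0 then 0 else x.map (ZeroHom.mk (fun a : A => a ^ q) (zero_pow hq))

/-- Entrywise `σ` on matrices of Laurent series. -/
def matFrob (q : ℕ) {n : Type*} (M : Matrix n n (LaurentSeries A)) :
    Matrix n n (LaurentSeries A) :=
  M.map (laurentFrob q)

/-- `x` lies in `z^n · A⟦z⟧`, i.e. all coefficients below `n` vanish. -/
def InZPow (n : ℤ) (x : LaurentSeries A) : Prop :=
  ∀ m : ℤ, m < n → x.coeff m = 0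

/-- `x` lies in the subring `A⟦z⟧` of `A((z))`. -/
def InPS (x : LaurentSeries A) : Prop :=
  ∀ m : ℤ, m < 0 → x.coeff m = 0

/-- `u` is a unit of the subring `A⟦z⟧` of `A((z))`. -/
def IsPSUnit (u : LaurentSeries A) : Prop :=
  InPS u ∧ ∃ v : LaurentSeries A, InPS v ∧ u * v = 1

/-- The element `z^n` of `A((z))`. -/
def zPow (n : ℤ) : LaurentSeries A :=
  HahnSeries.single n 1

/-- The coefficientwise map on Laurent series induced by a ring homomorphism. -/
def lmap {B : Type*} [CommRing B] (f : A →+* B) (x : LaurentSeries A) : LaurentSeries B :=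
  x.map f

variable {k : Type*} [Field k]

/-- Membership in the subgroup `I_n` of `GL_r(k⟦z⟧)`:  `g` and its inverse have entries in
`k⟦z⟧`, `g ≡ 1 mod z^n` on the diagonal, the entries above the diagonal lie in `z^n k⟦z⟧` and
those below the diagonal lie in `z^(n+1) k⟦z⟧`.  For `n = 0` this is the standard Iwahori
subgroup. -/
def InIwahori {r : ℕ} (n : ℕ) (g : Matrix (Fin r) (Fin r) (LaurentSeries k)) : Prop :=
  (∀ i j, InPS (g i j)) ∧ IsUnit g ∧ (∀ i j, InPS (g⁻¹ i j)) ∧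
  (∀ i : Fin r, InZPow (n : ℤ) (g i i - 1)) ∧
  (∀ i j : Fin r, i < j → InZPow (n : ℤ) (g i j)) ∧
  (∀ i j : Fin r, j < i → InZPow ((n : ℤ) + 1) (g i j))

/-- The sum of the `i` smallest (i.e. last `i`) entries of the nonincreasing tuple `μ`. -/
def lowSum {r : ℕ} (μ : Fin r → ℤ) (i : ℕ) : ℤ :=
  ∑ j : Fin r, if r ≤ (j : ℕ) + i then μ j else 0

/-- The matrix `M` over `A((z))` is bounded by the dominant cocharacter
`μ = (μ 0 ≥ … ≥ μ (r-1))` of `GL_r`: for each `1 ≤ i ≤ r` every `i×i` minor of `M` lies in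
`z^(μ_{r-i+1}+⋯+μ_r)·A⟦z⟧` and `det M = z^(μ_1+⋯+μ_r)` times a unit of `A⟦z⟧`. -/
def BoundedBy {r : ℕ} (μ : Fin r → ℤ) (M : Matrix (Fin r) (Fin r) (LaurentSeries A)) : Prop :=
  (∀ i : Fin r, ∀ ri ci : Fin ((i : ℕ) + 1) → Fin r,
    InZPow (lowSum μ ((i : ℕ) + 1)) ((M.submatrix ri ci).det)) ∧
  (∃ u : LaurentSeries A, IsPSUnit u ∧ M.det = zPow (∑ j, μ j) * u)


/-- For a prime `𝔭` of `R`, the canonical homomorphism from `R` to `K_𝔭`, an algebraic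
closure of the fraction field of `R ⧸ 𝔭`. -/
def ptHom {R : Type*} [CommRing R] (𝔭 : PrimeSpectrum R) :
    R →+* AlgebraicClosure (FractionRing (R ⧸ 𝔭.asIdeal)) :=
  ((algebraMap (FractionRing (R ⧸ 𝔭.asIdeal))
      (AlgebraicClosure (FractionRing (R ⧸ 𝔭.asIdeal)))).comp
    ((algebraMap (R ⧸ 𝔭.asIdeal) (FractionRing (R ⧸ 𝔭.asIdeal))).comp
      (Ideal.Quotient.mk 𝔭.asIdeal)))

theorem val_of_prime {K : Type*} [Field K] (S : Subring K) (P : Ideal S) [P.IsPrime] :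
    ∃ V : ValuationSubring K, (∀ x : S, V.valuation (x : K) ≤ 1) ∧
      (∀ x ∈ P, V.valuation (x : K) < 1) ∧ (∀ x ∉ P, V.valuation (x : K) = 1) := by
  obtain ⟨V, hV⟩ := (LocalSubring.ofPrime S P).exists_le_valuationSubring
  have hle : ∀ x : S, (x : K) ∈ V := fun x => hV.1 (LocalSubring.le_ofPrime S P x.2)
  have key : ∀ x : S, V.valuation (x : K) = 1 ↔ x ∉ P := by
    intro x
    have h1 := V.valuation_eq_one_iff ⟨(x : K), hle x⟩
    have h2 := IsLocalization.AtPrime.isUnit_to_map_iff (LocalSubring.ofPrime S P).toSubring P x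
    have : IsUnit (⟨(x : K), hle x⟩ : V) ↔
        IsUnit (algebraMap S (LocalSubring.ofPrime S P).toSubring x) := by
      have := hV.2
      exact isUnit_map_iff (Subring.inclusion hV.1)
        (algebraMap S (LocalSubring.ofPrime S P).toSubring x)
    rw [← this] at h2
    rw [← h1, h2]; rfl
  refine ⟨V, fun x => (V.valuation_le_one_iff _).2 (hle x), fun x hx => ?_, fun x hx => (key x).2 hx⟩
  refine lt_of_le_of_ne ((V.valuation_le_one_iff _).2 (hle x)) fun h => (key x).1 h hx

/-- coarsening -/
def coarsen {K : Type*} [Field K] (O : ValuationSubring K) (a : K) (ha : O.valuation a < 1)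
    (q : ℕ) (hq : 2 ≤ q) : ValuationSubring K where
  carrier := {x | ∀ j : ℕ, O.valuation x ^ (q ^ j) * O.valuation a ≤ 1}
  mul_mem' := by
    intro x y hx hy j
    rw [map_mul]
    have h1 := mul_le_one' (hx (j+1)) (hy (j+1))
    have hq0 : q ≠ 0 := by omega
    rw [← pow_le_one_iff hq0]
    refine le_trans ?_ h1
    have h2 : O.valuation a ^ q ≤ O.valuation a ^ 2 := pow_le_pow_right_of_le_one' ha.le hq
    calc _ = (O.valuation x * O.valuation y) ^ (q ^ (j+1)) * O.valuation a ^ q := by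
          rw [mul_pow _ (O.valuation a), ← pow_mul, pow_succ]
      _ ≤ (O.valuation x * O.valuation y) ^ (q ^ (j+1)) * O.valuation a ^ 2 := by gcongr
      _ = _ := by rw [mul_pow, sq]; ac_rfl
  one_mem' := by intro j; simpa using ha.le
  add_mem' := by
    intro x y hx hy j
    rcases le_max_iff.1 (O.valuation.map_add x y) with h | h
    · refine le_trans ?_ (hx j); gcongr
    · refine le_trans ?_ (hy j); gcongr
  zero_mem' := by
    intro j
    have : q ^ j ≠ 0 := pow_ne_zero _ (by omega)
    simp [zero_pow this]
  neg_mem' := by intro x hx j; simpa using hx j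
  mem_or_inv_mem' := by
    have : ∀ x, O.valuation x ≤ 1 → ∀ j : ℕ, O.valuation x ^ (q ^ j) * O.valuation a ≤ 1 :=
      fun x hx j => mul_le_one' (pow_le_one' hx _) ha.le
    intro x
    rcases O.mem_or_inv_mem x with h | h
    · exact Or.inl (this _ ((O.valuation_le_one_iff _).2 h))
    · exact Or.inr (this _ ((O.valuation_le_one_iff _).2 h))

theorem exists_val {D K : Type*} [CommRing D] [IsDomain D] [IsNoetherianRing D] [IsLocalRing D]
    [Field K] [Algebra D K] [FaithfulSMul D K] [Algebra.IsAlgebraic D K]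
    (hD : ¬ IsField D) (q : ℕ) (hq : 2 ≤ q) :
    ∃ V : ValuationSubring K, ∃ a : K, a ≠ 0 ∧ V.valuation a < 1 ∧
      (∀ d : D, V.valuation (algebraMap D K d) ≤ 1) ∧
      (∀ d ∈ IsLocalRing.maximalIdeal D, V.valuation (algebraMap D K d) ≤ V.valuation a) ∧
      (∀ x : K, ∃ n : ℕ, V.valuation x * V.valuation a ^ n ≤ 1) ∧
      (∀ x : K, (∀ j : ℕ, V.valuation x ^ (q ^ j) * V.valuation a ≤ 1) → V.valuation x ≤ 1) := by
  have hinj : Function.Injective (algebraMap D K) := FaithfulSMul.algebraMap_injective D K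
  obtain ⟨V₁, hV₁⟩ := (LocalSubring.range (algebraMap D K)).exists_le_valuationSubring
  have h11 : ∀ d : D, V₁.valuation (algebraMap D K d) ≤ 1 := fun d =>
    (V₁.valuation_le_one_iff _).2 (hV₁.1 ⟨d, rfl⟩)
  have h12 : ∀ d ∈ IsLocalRing.maximalIdeal D, V₁.valuation (algebraMap D K d) < 1 := by
    intro d hd
    refine lt_of_le_of_ne (h11 d) fun h => ?_
    have h1 := V₁.valuation_eq_one_iff ⟨algebraMap D K d, hV₁.1 ⟨d, rfl⟩⟩
    have h2 := h1.2 h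
    have h3 : IsUnit (⟨algebraMap D K d, ⟨d, rfl⟩⟩ : (LocalSubring.range (algebraMap D K)).toSubring) := by
      have := hV₁.2
      exact (isUnit_map_iff (Subring.inclusion hV₁.1) _).1 h2
    obtain ⟨⟨_, ⟨u, rfl⟩⟩, hu⟩ := isUnit_iff_exists_inv.1 h3
    have h4 : algebraMap D K d * algebraMap D K u = 1 := congrArg Subtype.val hu
    rw [← map_mul, ← map_one (algebraMap D K)] at h4
    exact (IsLocalRing.mem_maximalIdeal _).1 hd (IsUnit.of_mul_eq_one _ (hinj h4))
  obtain ⟨G, hG⟩ := (isNoetherianRing_iff_ideal_fg D).1 inferInstance (IsLocalRing.maximalIdeal D)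
  have hGne : G.Nonempty := by
    rw [Finset.nonempty_iff_ne_empty]
    rintro rfl
    rw [Finset.coe_empty, Ideal.span_empty] at hG
    exact hD (IsLocalRing.isField_iff_maximalIdeal_eq.2 hG.symm)
  obtain ⟨a₀, ha₀G, hmax⟩ := G.exists_max_image (fun d => V₁.valuation (algebraMap D K d)) hGne
  have hGm : ∀ g ∈ G, g ∈ IsLocalRing.maximalIdeal D := fun g hg => hG ▸ Ideal.subset_span hg
  have ha₀0 : a₀ ≠ 0 := by
    rintro rfl
    apply hD
    rw [IsLocalRing.isField_iff_maximalIdeal_eq, ← hG, Ideal.span_eq_bot]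
    intro g hg
    have := hmax g hg
    simp only [map_zero, le_zero_iff] at this
    have := (Valuation.zero_iff _).1 this
    exact hinj (by simpa using this)
  set a : K := algebraMap D K a₀ with ha_def
  have ha0 : a ≠ 0 := by rw [ha_def]; simpa using hinj.ne ha₀0
  let D' : Subalgebra D K := Algebra.adjoin D ((G.image fun g => algebraMap D K g / a : Finset K) : Set K)
  have hD'noeth : IsNoetherianRing D' := by
    have : D'.FG := ⟨_, rfl⟩
    have := (Subalgebra.fg_iff_finiteType D').1 this
    exact Algebra.FiniteType.isNoetherianRing D D'
  have hD'V : ∀ x ∈ D', V₁.valuation x ≤ 1 := by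
    intro x hx
    induction hx using Algebra.adjoin_induction with
    | mem x hx =>
      simp only [Finset.coe_image, Set.mem_image, Finset.mem_coe] at hx
      obtain ⟨g, hg, rfl⟩ := hx
      rw [map_div₀]
      exact div_le_one_of_le₀ (hmax g hg) zero_le
    | algebraMap r => exact h11 r
    | add x y _ _ h1 h2 => exact (V₁.valuation.map_add x y).trans (max_le h1 h2)
    | mul x y _ _ h1 h2 => rw [map_mul]; exact mul_le_one' h1 h2
  let S : Subring K := D'.toSubring
  have : IsNoetherianRing S := hD'noeth
  let aS : S := ⟨a, D'.algebraMap_mem a₀⟩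
  have haS : Ideal.span {aS} ≠ ⊤ := by
    rw [Ne, Ideal.span_singleton_eq_top]
    intro h
    obtain ⟨u, hu⟩ := isUnit_iff_exists_inv.1 h
    have h4 : a * (u : K) = 1 := congrArg Subtype.val hu
    have h5 := congrArg V₁.valuation h4
    rw [map_mul, map_one] at h5
    have h6 := h12 a₀ (hGm _ ha₀G)
    have h7 := hD'V u u.2
    exact absurd h5 (ne_of_lt (mul_lt_one_of_lt_of_le h6 h7))
  obtain ⟨P, hPmin⟩ := Ideal.nonempty_minimalPrimes haS
  have hPp : P.IsPrime := hPmin.1.1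
  have haP : aS ∈ P := hPmin.1.2 (Ideal.subset_span rfl)
  have hht : P.height ≤ 1 := Ideal.height_le_one_of_isPrincipal_of_mem_minimalPrimes _ P hPmin
  obtain ⟨O, hO1, hO2, hO3⟩ := val_of_prime S P
  have hOa : O.valuation a < 1 := hO2 aS haP
  have hdiv : ∀ w : S, w ≠ 0 → ∃ n : ℕ, O.valuation a ^ n ≤ O.valuation (w : K) := by
    intro w hw
    by_contra hcon
    push Not at hcon
    let M : Submonoid S := P.primeCompl ⊔ Submonoid.powers aS
    have hdisj : Disjoint ((Ideal.span {w} : Ideal S) : Set S) M := by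
      rw [Set.disjoint_left]
      intro x hx hxM
      obtain ⟨s, hs, t, ht, rfl⟩ := Submonoid.mem_sup.1 hxM
      obtain ⟨n, rfl⟩ := ht
      obtain ⟨c, hc⟩ := Ideal.mem_span_singleton'.1 hx
      have h1 : (c : K) * w = s * a ^ n := congrArg Subtype.val hc
      have h2 := congrArg O.valuation h1
      rw [map_mul, map_mul, map_pow, hO3 s hs, one_mul] at h2
      have h3 := hcon n
      rw [← h2] at h3
      exact absurd h3 (not_lt.2 (mul_le_of_le_one_left' (hO1 c)))
    obtain ⟨Q, hQp, hQle, hQd⟩ := Ideal.exists_le_prime_disjoint _ M hdisj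
    have hQP : Q < P := by
      refine lt_of_le_of_ne ?_ ?_
      · intro x hx
        by_contra hxP
        exact Set.disjoint_left.1 hQd hx (Submonoid.mem_sup_left (show x ∈ P.primeCompl from hxP))
      · rintro rfl
        exact Set.disjoint_left.1 hQd haP (Submonoid.mem_sup_right (Submonoid.mem_powers aS))
    have h0Q : (⊥ : Ideal S) < Q := by
      refine lt_of_le_of_ne bot_le fun h => hw ?_
      have : w ∈ Q := hQle (Ideal.subset_span rfl)
      rw [← h] at this
      simpa using this
    have h1 := Ideal.height_add_one_le_of_lt_of_isPrime h0Q
    have h2 := Ideal.height_add_one_le_of_lt_of_isPrime hQP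
    have h3 := h2.trans hht
    have : (1 : ℕ∞) + 1 ≤ 1 := by
      refine le_trans ?_ h3
      gcongr
      exact le_trans le_add_self h1
    exact absurd this (by decide)
  have hP2 : ∀ x : K, ∃ n : ℕ, O.valuation x * O.valuation a ^ n ≤ 1 := by
    intro x
    obtain ⟨d, hd0, hdx⟩ := (Algebra.IsAlgebraic.isAlgebraic (R := D) x).exists_integral_multiple
    have h1 : O.valuation (d • x) ≤ 1 := by
      have : IsIntegral O (d • x) := by
        let f : D →+* O := (algebraMap D K).codRestrict O.toSubring fun d =>
          (O.valuation_le_one_iff _).1 (hO1 ⟨algebraMap D K d, D'.algebraMap_mem d⟩)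
        obtain ⟨p, hp, hpx⟩ := hdx
        refine ⟨p.map f, hp.map f, ?_⟩
        rw [Polynomial.eval₂_map]
        exact hpx
      obtain ⟨y, hy⟩ := IsIntegrallyClosed.isIntegral_iff.1 this
      rw [← hy]
      exact (O.valuation_le_one_iff _).2 y.2
    obtain ⟨n, hn⟩ := hdiv ⟨algebraMap D K d, D'.algebraMap_mem d⟩
      (fun h => hd0 (hinj (by simpa using congrArg Subtype.val h)))
    refine ⟨n, le_trans ?_ h1⟩
    rw [Algebra.smul_def, map_mul, mul_comm]
    gcongr
  let V := coarsen O a hOa q hq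
  have hmem : ∀ x, V.valuation x ≤ 1 ↔ ∀ j : ℕ, O.valuation x ^ (q ^ j) * O.valuation a ≤ 1 :=
    fun x => V.valuation_le_one_iff x
  have hOV : ∀ x, O.valuation x ≤ 1 → V.valuation x ≤ 1 :=
    fun x hx => (hmem x).2 fun j => mul_le_one' (pow_le_one' hx _) hOa.le
  have hα0 : 0 < O.valuation a := by
    rw [zero_lt_iff]; exact (Valuation.ne_zero_iff _).2 ha0
  refine ⟨V, a, ha0, ?_, fun d => hOV _ (hO1 ⟨algebraMap D K d, D'.algebraMap_mem d⟩), ?_, ?_, ?_⟩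
  · refine lt_of_le_of_ne (hOV a hOa.le) fun h => ?_
    have h1 : V.valuation a⁻¹ ≤ 1 := by rw [map_inv₀, h, inv_one]
    have h2 := (hmem _).1 h1 1
    rw [pow_one, map_inv₀, inv_pow, inv_mul_le_iff₀ (pow_pos hα0 _), mul_one] at h2
    have h3 : O.valuation a ^ q ≤ O.valuation a ^ 2 := pow_le_pow_right_of_le_one' hOa.le hq
    have h4 := h2.trans h3
    rw [sq] at h4
    exact absurd h4 (not_le.2 (mul_lt_of_lt_one_left hα0 hOa))
  · intro d hd
    have h1 : V.valuation (algebraMap D K d / a) ≤ 1 := by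
      apply hOV
      have : algebraMap D K d / a ∈ D' := by
        rw [← hG] at hd
        induction hd using Submodule.span_induction with
        | mem g hg =>
          exact Algebra.subset_adjoin (by simp only [Finset.coe_image]; exact ⟨g, hg, rfl⟩)
        | zero => simp
        | add x y _ _ h1 h2 => rw [map_add, add_div]; exact add_mem h1 h2
        | smul c x _ h =>
          rw [smul_eq_mul, map_mul, mul_div_assoc]; exact mul_mem (D'.algebraMap_mem c) h
      exact hO1 ⟨_, this⟩
    rw [map_div₀] at h1
    exact (div_le_one₀ (zero_lt_iff.2 ((Valuation.ne_zero_iff _).2 ha0))).1 h1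
  · intro x
    obtain ⟨n, hn⟩ := hP2 x
    refine ⟨n, ?_⟩
    rw [← map_pow, ← map_mul] at hn ⊢
    exact hOV _ hn
  · intro x hx
    rw [hmem]
    intro j
    have h1 := hx (j+1)
    rw [← map_pow, ← map_mul, hmem] at h1
    have h2 := h1 1
    rw [map_mul, map_pow, pow_one, mul_pow, ← pow_mul, ← pow_succ, mul_assoc, ← pow_succ] at h2
    have hq2 : q ^ 2 ≠ 0 := pow_ne_zero _ (by omega)
    rw [← pow_le_one_iff hq2]
    refine le_trans ?_ h2
    rw [mul_pow, ← pow_mul, ← pow_add]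
    refine mul_le_mul' le_rfl (pow_le_pow_right_of_le_one' hOa.le ?_)
    nlinarith

/-! ## Generalities on coefficients -/

/-- `q`-th power is additive. -/
def FrobAdd (q : ℕ) (B : Type*) [CommRing B] : Prop :=
  q ≠ 0 ∧ ∀ x y : B, (x + y) ^ q = x ^ q + y ^ q

theorem FrobAdd.pow {q : ℕ} {B : Type*} [CommRing B] (h : FrobAdd q B) (t : ℕ) :
    FrobAdd (q ^ t) B := by
  refine ⟨pow_ne_zero _ h.1, ?_⟩
  induction t with
  | zero => intro x y; simp
  | succ t ih => intro x y; rw [pow_succ, pow_mul, ih, h.2, pow_mul, pow_mul]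

/-- The `q`-power ring endomorphism. -/
def powHom {q : ℕ} {B : Type*} [CommRing B] (h : FrobAdd q B) : B →+* B where
  toFun x := x ^ q
  map_one' := one_pow q
  map_mul' x y := mul_pow x y q
  map_zero' := zero_pow h.1
  map_add' := h.2

theorem laurentFrob_coeff {q : ℕ} (hq : q ≠ 0) {B : Type*} [CommRing B] (x : LaurentSeries B)
    (n : ℤ) : (laurentFrob q x).coeff n = x.coeff n ^ q := by
  simp [laurentFrob, hq]

theorem matFrob_coeff {q : ℕ} (hq : q ≠ 0) {B : Type*} [CommRing B] {ι : Type*}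
    (M : Matrix ι ι (LaurentSeries B)) (i j : ι) (n : ℤ) :
    (matFrob q M i j).coeff n = (M i j).coeff n ^ q :=
  laurentFrob_coeff hq _ n

/-- `lmap` as a ring homomorphism. -/
def lmapHom {B C : Type*} [CommRing B] [CommRing C] (f : B →+* C) :
    LaurentSeries B →+* LaurentSeries C where
  toFun := lmap f
  map_one' := by
    ext n
    simp only [lmap, HahnSeries.map_coeff, HahnSeries.coeff_one]
    split_ifs <;> simp
  map_zero' := by ext n; simp [lmap]
  map_add' x y := by ext n; simp [lmap]
  map_mul' x y := by
    have := HahnSeries.map_mul (f : B →ₙ+* C) (x := x) (y := y)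
    exact this

theorem lmap_coeff {B C : Type*} [CommRing B] [CommRing C] (f : B →+* C) (x : LaurentSeries B)
    (n : ℤ) : (lmap f x).coeff n = f (x.coeff n) := rfl

theorem laurentFrob_eq {q : ℕ} {B : Type*} [CommRing B] (h : FrobAdd q B) (x : LaurentSeries B) :
    laurentFrob q x = lmapHom (powHom h) x := by
  ext n
  rw [laurentFrob_coeff h.1]; rfl

theorem matFrob_eq {q : ℕ} {B : Type*} [CommRing B] (h : FrobAdd q B) {r : ℕ}
    (M : Matrix (Fin r) (Fin r) (LaurentSeries B)) :
    matFrob q M = (lmapHom (powHom h)).mapMatrix M := by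
  ext1 i j
  exact laurentFrob_eq h _

theorem matFrob_mul {q : ℕ} {B : Type*} [CommRing B] (h : FrobAdd q B) {r : ℕ}
    (M N : Matrix (Fin r) (Fin r) (LaurentSeries B)) :
    matFrob q (M * N) = matFrob q M * matFrob q N := by
  simp only [matFrob_eq h, map_mul]

theorem matFrob_one {q : ℕ} {B : Type*} [CommRing B] (h : FrobAdd q B) {r : ℕ} :
    matFrob q (1 : Matrix (Fin r) (Fin r) (LaurentSeries B)) = 1 := by
  simp only [matFrob_eq h, map_one]

theorem matFrob_sub {q : ℕ} {B : Type*} [CommRing B] (h : FrobAdd q B) {r : ℕ}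
    (M N : Matrix (Fin r) (Fin r) (LaurentSeries B)) :
    matFrob q (M - N) = matFrob q M - matFrob q N := by
  simp only [matFrob_eq h, map_sub]

theorem matFrob_comp {q : ℕ} (hq : q ≠ 0) {B : Type*} [CommRing B] {r : ℕ} (t : ℕ)
    (M : Matrix (Fin r) (Fin r) (LaurentSeries B)) :
    matFrob (q ^ t) (matFrob q M) = matFrob (q ^ (t + 1)) M := by
  ext i j n
  rw [matFrob_coeff (pow_ne_zero _ hq), matFrob_coeff hq, matFrob_coeff (pow_ne_zero _ hq),
    ← pow_mul, pow_succ, mul_comm]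

theorem matFrob_lmap {q : ℕ} (hq : q ≠ 0) {B C : Type*} [CommRing B] [CommRing C] (f : B →+* C)
    {r : ℕ} (M : Matrix (Fin r) (Fin r) (LaurentSeries B)) :
    matFrob q (M.map (lmap f)) = (matFrob q M).map (lmap f) := by
  ext i j n
  rw [matFrob_coeff hq, Matrix.map_apply, Matrix.map_apply, lmap_coeff, lmap_coeff,
    matFrob_coeff hq, map_pow]

theorem map_lmap_mul {B C : Type*} [CommRing B] [CommRing C] (f : B →+* C)
    {r : ℕ} (M N : Matrix (Fin r) (Fin r) (LaurentSeries B)) :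
    (M * N).map (lmap f) = M.map (lmap f) * N.map (lmap f) :=
  map_mul (lmapHom f).mapMatrix M N

theorem map_lmap_one {B C : Type*} [CommRing B] [CommRing C] (f : B →+* C) {r : ℕ} :
    (1 : Matrix (Fin r) (Fin r) (LaurentSeries B)).map (lmap f) = 1 :=
  map_one (lmapHom f).mapMatrix

theorem map_lmap_sub {B C : Type*} [CommRing B] [CommRing C] (f : B →+* C)
    {r : ℕ} (M N : Matrix (Fin r) (Fin r) (LaurentSeries B)) :
    (M - N).map (lmap f) = M.map (lmap f) - N.map (lmap f) :=
  map_sub (lmapHom f).mapMatrix M N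

theorem coeff_mul_mem {B : Type*} [CommRing B] (S : AddSubmonoid B) (f g : LaurentSeries B) (n : ℤ)
    (h : ∀ i j, i + j = n → f.coeff i * g.coeff j ∈ S) : (f * g).coeff n ∈ S := by
  rw [HahnSeries.coeff_mul]
  refine sum_mem fun ij hij => h _ _ ?_
  simpa using (Finset.mem_antidiagonal.1 hij).2.2

theorem mat_coeff_mul_mem {B : Type*} [CommRing B] (S : AddSubmonoid B) {r : ℕ}
    (M N : Matrix (Fin r) (Fin r) (LaurentSeries B)) (i j : Fin r) (n : ℤ)
    (h : ∀ l a b, a + b = n → (M i l).coeff a * (N l j).coeff b ∈ S) :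
    ((M * N) i j).coeff n ∈ S := by
  rw [Matrix.mul_apply, HahnSeries.coeff_sum]
  exact sum_mem fun l _ => coeff_mul_mem S _ _ n (h l)

theorem mat_coeff_sub {B : Type*} [CommRing B] {r : ℕ}
    (M N : Matrix (Fin r) (Fin r) (LaurentSeries B)) (i j : Fin r) (n : ℤ) :
    ((M - N) i j).coeff n = (M i j).coeff n - (N i j).coeff n := rfl

/-- a common lower bound for the supports -/
theorem exists_low {B : Type*} [CommRing B] {r : ℕ}
    (M : Matrix (Fin r) (Fin r) (LaurentSeries B)) :
    ∃ N : ℕ, ∀ i j (n : ℤ), n < -(N : ℤ) → (M i j).coeff n = 0 := by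
  have h1 : ∀ i j, ∃ N : ℕ, ∀ n : ℤ, n < -(N : ℤ) → (M i j).coeff n = 0 := fun i j =>
    ⟨(M i j).order.natAbs, fun n hn => HahnSeries.coeff_eq_zero_of_lt_order (by omega)⟩
  choose N hN using h1
  refine ⟨∑ i, ∑ j, N i j, fun i j n hn => hN i j n ?_⟩
  have h2 : N i j ≤ ∑ j, N i j := Finset.single_le_sum (f := fun j => N i j) (by simp) (Finset.mem_univ j)
  have h3 : (∑ j, N i j) ≤ ∑ i, ∑ j, N i j :=
    Finset.single_le_sum (f := fun i => ∑ j, N i j) (by simp) (Finset.mem_univ i)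
  omega

/-- The elements of valuation at most `γ`. -/
def leSub {K Γ : Type*} [Field K] [LinearOrderedCommGroupWithZero Γ] (v : Valuation K Γ) (γ : Γ) :
    AddSubmonoid K where
  carrier := {x | v x ≤ γ}
  zero_mem' := by simp
  add_mem' {x y} hx hy := (v.map_add x y).trans (max_le hx hy)

/-- The elements of valuation less than one. -/
def ltSub {K Γ : Type*} [Field K] [LinearOrderedCommGroupWithZero Γ] (v : Valuation K Γ) :
    AddSubmonoid K where
  carrier := {x | v x < 1}
  zero_mem' := by simp
  add_mem' {x y} hx hy := (v.map_add x y).trans_lt (max_lt hx hy)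

/-! ## Factorization `y = g k` -/

theorem factor {K : Type*} [Field K] {r : ℕ} (y f : Matrix (Fin r) (Fin r) (LaurentSeries K))
    (hyf : y * f = 1) :
    ∃ g k l : Matrix (Fin r) (Fin r) (LaurentSeries K), y = g * k ∧ k * l = 1 ∧
      (∃ lo hi : ℕ, ∀ i j (n : ℤ), (n < -(lo : ℤ) ∨ (hi : ℤ) ≤ n) → (g i j).coeff n = 0) ∧
      (∀ i j (n : ℤ), n ≤ 0 → ((k - 1) i j).coeff n = 0) ∧
      (∀ i j (n : ℤ), n ≤ 0 → ((l - 1) i j).coeff n = 0) := by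
  have hfy : f * y = 1 := mul_eq_one_comm.1 hyf
  obtain ⟨lo, hlo⟩ := exists_low y
  obtain ⟨M, hM⟩ := exists_low f
  let g : Matrix (Fin r) (Fin r) (LaurentSeries K) :=
    y.map (HahnSeries.truncLT ((M + 1 : ℕ) : ℤ))
  have hg : ∀ i j (n : ℤ), (g i j).coeff n = if n < ((M + 1 : ℕ) : ℤ) then (y i j).coeff n else 0 := by
    intro i j n
    simp only [g, Matrix.map_apply, HahnSeries.coeff_truncLT]
  have hl : ∀ i j (n : ℤ), n ≤ 0 → ((f * g - 1) i j).coeff n = 0 := by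
    intro i j n hn
    have : f * g - 1 = f * (g - y) := by rw [mul_sub, hfy]
    rw [this]
    have := mat_coeff_mul_mem (⊥ : AddSubmonoid K) f (g - y) i j n ?_
    · simpa using this
    · intro l a b hab
      rw [AddSubmonoid.mem_bot]
      by_cases ha : a < -(M : ℤ)
      · rw [hM _ _ _ ha, zero_mul]
      · rw [mat_coeff_sub, hg, if_pos (by push_cast; omega), sub_self, mul_zero]
  let L : Matrix (Fin r) (Fin r) (PowerSeries K) :=
    fun i j => PowerSeries.mk fun n => ((f * g) i j).coeff (n : ℤ)
  have hL : (HahnSeries.ofPowerSeries ℤ K).mapMatrix L = f * g := by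
    ext i j n
    simp only [RingHom.mapMatrix_apply, Matrix.map_apply, PowerSeries.coeff_coe]
    split_ifs with h
    · have := hl i j n h.le
      rw [mat_coeff_sub, sub_eq_zero] at this
      rw [this, Matrix.one_apply]
      split_ifs
      · rw [HahnSeries.coeff_one, if_neg h.ne]
      · rfl
    · simp only [L, PowerSeries.coeff_mk]
      congr 1
      omega
  have hLc : (PowerSeries.constantCoeff (R := K)).mapMatrix L = 1 := by
    ext i j
    have := hl i j 0 le_rfl
    rw [mat_coeff_sub, sub_eq_zero] at this
    change PowerSeries.constantCoeff (PowerSeries.mk fun n : ℕ => ((f * g) i j).coeff (n : ℤ)) = _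
    rw [← PowerSeries.coeff_zero_eq_constantCoeff_apply, PowerSeries.coeff_mk, Nat.cast_zero, this, Matrix.one_apply, Matrix.one_apply]
    split_ifs <;> simp
  have hLu : IsUnit L := by
    rw [Matrix.isUnit_iff_isUnit_det, PowerSeries.isUnit_iff_constantCoeff, RingHom.map_det, hLc]
    simp
  obtain ⟨Li, hLi1⟩ := hLu.exists_left_inv
  have hLic : (PowerSeries.constantCoeff (R := K)).mapMatrix Li = 1 := by
    have := congrArg (PowerSeries.constantCoeff (R := K)).mapMatrix hLi1
    rw [map_mul, hLc, mul_one, map_one] at this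
    exact this
  let k := (HahnSeries.ofPowerSeries ℤ K).mapMatrix Li
  have hkl : k * (f * g) = 1 := by rw [← hL, ← map_mul, hLi1, map_one]
  refine ⟨g, k, f * g, ?_, hkl, ⟨lo, M + 1, ?_⟩, ?_, hl⟩
  · have h2 : (f * g) * k = 1 := mul_eq_one_comm.1 hkl
    calc y = y * ((f * g) * k) := by rw [h2, mul_one]
      _ = (y * f) * (g * k) := by simp only [mul_assoc]
      _ = g * k := by rw [hyf, one_mul]
  · rintro i j n (h | h)
    · rw [hg, hlo _ _ _ h, ite_self]
    · rw [hg, if_neg (not_lt.2 h)]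
  · intro i j n hn
    rw [mat_coeff_sub, sub_eq_zero]
    simp only [k, RingHom.mapMatrix_apply, Matrix.map_apply, PowerSeries.coeff_coe]
    split_ifs with h
    · rw [Matrix.one_apply]
      split_ifs
      · rw [HahnSeries.coeff_one, if_neg h.ne]
      · rfl
    · have h0 : n = 0 := by omega
      subst h0
      have := congrFun (congrFun hLic i) j
      simp only [RingHom.mapMatrix_apply, Matrix.map_apply] at this
      rw [Int.natAbs_zero, PowerSeries.coeff_zero_eq_constantCoeff_apply, this, Matrix.one_apply,
        Matrix.one_apply]
      split_ifs <;> simp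

/-! ## Boundedness -/

/-- Laurent series with bounded coefficients. -/
def bddSub {K Γ : Type*} [Field K] [LinearOrderedCommGroupWithZero Γ] (v : Valuation K Γ) (α : Γ)
    (hα : 1 ≤ α) : Subring (LaurentSeries K) where
  carrier := {f | ∃ s : ℕ, ∀ n, v (f.coeff n) ≤ α ^ s}
  mul_mem' := by
    rintro f g ⟨s, hs⟩ ⟨t, ht⟩
    refine ⟨s + t, fun n => coeff_mul_mem (leSub v (α ^ (s + t))) f g n fun i j _ => ?_⟩
    change v _ ≤ _
    rw [map_mul, pow_add]
    exact mul_le_mul' (hs i) (ht j)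
  one_mem' := by
    refine ⟨0, fun n => ?_⟩
    rw [HahnSeries.coeff_one]
    split_ifs <;> simp
  zero_mem' := ⟨0, fun n => by simp⟩
  add_mem' := by
    rintro f g ⟨s, hs⟩ ⟨t, ht⟩
    refine ⟨s + t, fun n => (v.map_add _ _).trans (max_le ((hs n).trans ?_) ((ht n).trans ?_))⟩
    · exact pow_le_pow_right' hα (by omega)
    · exact pow_le_pow_right' hα (by omega)
  neg_mem' := by
    rintro f ⟨s, hs⟩
    exact ⟨s, fun n => by simpa using hs n⟩

/-! ## Growth of solutions -/

theorem mat_eq_mapMatrix {B : Type*} [CommRing B] (S : Subring B) {r : ℕ}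
    (M : Matrix (Fin r) (Fin r) B) (h : ∀ i j, M i j ∈ S) :
    ∃ N : Matrix (Fin r) (Fin r) S, S.subtype.mapMatrix N = M :=
  ⟨fun i j => ⟨M i j, h i j⟩, rfl⟩

theorem growth_k {K Γ : Type*} [Field K] [LinearOrderedCommGroupWithZero Γ] (v : Valuation K Γ)
    (α : Γ) (hα : 1 ≤ α) (hP2 : ∀ x : K, ∃ n : ℕ, v x ≤ α ^ n)
    {q : ℕ} (hq : 2 ≤ q) (hF : FrobAdd q K) {r : ℕ}
    (b y f g k l : Matrix (Fin r) (Fin r) (LaurentSeries K))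
    (hyf : y * f = 1) (hb : ∀ i j n, v ((b i j).coeff n) ≤ 1) (hby : b * matFrob q y = y)
    (hygk : y = g * k) (hkl : k * l = 1)
    (hg : ∀ i j, ∃ s : ℕ, ∀ n, v ((g i j).coeff n) ≤ α ^ s)
    (hk1 : ∀ i j (n : ℤ), n ≤ 0 → ((k - 1) i j).coeff n = 0)
    (hl1 : ∀ i j (n : ℤ), n ≤ 0 → ((l - 1) i j).coeff n = 0) :
    ∃ c : ℕ, ∀ i j (n : ℤ), v ((k i j).coeff n) ≤ α ^ ((c : ℤ) * n) := by
  have hq0 : q ≠ 0 := hF.1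
  have hα0 : α ≠ 0 := (lt_of_lt_of_le zero_lt_one hα).ne'
  let S := bddSub v α hα
  have hgS : ∀ i j, g i j ∈ S := hg
  have hbS : ∀ i j, b i j ∈ S := fun i j => ⟨0, fun n => by simpa using hb i j n⟩
  have hσgS : ∀ i j, matFrob q g i j ∈ S := by
    intro i j
    obtain ⟨s, hs⟩ := hg i j
    refine ⟨s * q, fun n => ?_⟩
    rw [matFrob_coeff hq0, map_pow, pow_mul]
    exact pow_le_pow_left' (hs n) q
  obtain ⟨g', rfl⟩ := mat_eq_mapMatrix S g hgS
  obtain ⟨b', rfl⟩ := mat_eq_mapMatrix S b hbS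
  obtain ⟨h', hh'⟩ := mat_eq_mapMatrix S _ hσgS
  set g := S.subtype.mapMatrix g' with hgdef
  set b := S.subtype.mapMatrix b' with hbdef
  let B := g.adjugate * b * matFrob q g
  let δ := g.det
  have hBS : ∀ i j, B i j ∈ S := by
    have : B = S.subtype.mapMatrix (g'.adjugate * b' * h') := by
      rw [map_mul, map_mul, RingHom.map_adjugate, hh']
    intro i j
    rw [this]
    exact (((g'.adjugate * b' * h') i j)).2
  have hδS : δ ∈ S := by
    have : δ = S.subtype g'.det := by rw [RingHom.map_det]
    rw [this]
    exact (g'.det).2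
  have hBk : B * matFrob q k = δ • k := by
    calc B * matFrob q k = g.adjugate * (b * (matFrob q g * matFrob q k)) := by
          simp only [B, mul_assoc]
      _ = g.adjugate * (b * matFrob q y) := by rw [← matFrob_mul hF, ← hygk]
      _ = g.adjugate * (g * k) := by rw [hby, ← hygk]
      _ = δ • k := by rw [← mul_assoc, Matrix.adjugate_mul, Matrix.smul_mul, one_mul]
  have hlk : l * k = 1 := mul_eq_one_comm.1 hkl
  have hδ0 : δ ≠ 0 := by
    have : g * (k * f) = 1 := by rw [← mul_assoc, ← hygk, hyf]
    have h1 := congrArg Matrix.det this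
    rw [Matrix.det_mul, Matrix.det_one] at h1
    intro h0
    rw [show g.det = 0 from h0, zero_mul] at h1
    exact zero_ne_one h1
  have hB : B = δ • (k * matFrob q l) := by
    rw [← Matrix.smul_mul, ← hBk, mul_assoc, ← matFrob_mul hF, hkl, matFrob_one hF, mul_one]
  let ε : LaurentSeries K := HahnSeries.single (-δ.order) (δ.coeff δ.order)⁻¹
  have hlead : δ.coeff δ.order ≠ 0 := fun h => hδ0 (HahnSeries.coeff_order_eq_zero.1 h)
  have hεS : ε ∈ S := by
    obtain ⟨s, hs⟩ := hP2 (δ.coeff δ.order)⁻¹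
    refine ⟨s, fun n => ?_⟩
    simp only [ε, HahnSeries.coeff_single]
    split_ifs
    · exact hs
    · simp
  have hδ1 : ∀ n : ℤ, n ≤ 0 → (ε * δ - 1).coeff n = 0 := by
    intro n hn
    rw [HahnSeries.coeff_sub, HahnSeries.coeff_single_mul, HahnSeries.coeff_one]
    split_ifs with h
    · subst h
      rw [zero_sub, neg_neg, inv_mul_cancel₀ hlead, sub_self]
    · rw [HahnSeries.coeff_eq_zero_of_lt_order (x := δ) (i := n - -δ.order) (by omega), mul_zero,
        sub_zero]
  have hσl : ∀ i j (n : ℤ), n ≤ 0 → ((matFrob q l - 1) i j).coeff n = 0 := by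
    intro i j n hn
    rw [← matFrob_one hF, ← matFrob_sub hF, matFrob_coeff hq0, hl1 i j n hn, zero_pow hq0]
  have hσl' : ∀ i j (n : ℤ), n < 0 → ((matFrob q l) i j).coeff n = 0 := by
    intro i j n hn
    have := hσl i j n hn.le
    rw [mat_coeff_sub, sub_eq_zero] at this
    rw [this, Matrix.one_apply]
    split_ifs
    · rw [HahnSeries.coeff_one, if_neg hn.ne]
    · rfl
  have hkσl : ∀ i j (n : ℤ), n ≤ 0 → ((k * matFrob q l - 1) i j).coeff n = 0 := by
    intro i j n hn
    have : k * matFrob q l - 1 = (k - 1) * matFrob q l + (matFrob q l - 1) := by noncomm_ring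
    rw [this, Matrix.add_apply, HahnSeries.coeff_add, hσl i j n hn, add_zero]
    have := mat_coeff_mul_mem (⊥ : AddSubmonoid K) (k - 1) (matFrob q l) i j n ?_
    · simpa using this
    · intro m a c hac
      rw [AddSubmonoid.mem_bot]
      by_cases ha : a ≤ 0
      · rw [hk1 _ _ _ ha, zero_mul]
      · rw [hσl' _ _ _ (by omega), mul_zero]
  have hkσl' : ∀ i j (n : ℤ), n < 0 → ((k * matFrob q l) i j).coeff n = 0 := by
    intro i j n hn
    have := hkσl i j n hn.le
    rw [mat_coeff_sub, sub_eq_zero] at this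
    rw [this, Matrix.one_apply]
    split_ifs
    · rw [HahnSeries.coeff_one, if_neg hn.ne]
    · rfl
  let δ₂ := ε * δ - 1
  let B₂ := ε • B - 1
  have hB₂ : ∀ i j (n : ℤ), n ≤ 0 → (B₂ i j).coeff n = 0 := by
    intro i j n hn
    have : B₂ = δ₂ • (k * matFrob q l) + (k * matFrob q l - 1) := by
      simp only [B₂, δ₂, hB, smul_smul, sub_smul, one_smul]; abel
    rw [this, Matrix.add_apply, HahnSeries.coeff_add, hkσl i j n hn, add_zero, Matrix.smul_apply,
      smul_eq_mul]
    have := coeff_mul_mem (⊥ : AddSubmonoid K) δ₂ ((k * matFrob q l) i j) n ?_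
    · simpa using this
    · intro a c hac
      rw [AddSubmonoid.mem_bot]
      by_cases ha : a ≤ 0
      · rw [hδ1 _ ha, zero_mul]
      · rw [hkσl' _ _ _ (by omega), mul_zero]
  have hB₂S : ∀ i j, B₂ i j ∈ S := by
    intro i j
    refine sub_mem (mul_mem hεS (hBS i j)) ?_
    rw [Matrix.one_apply]
    split_ifs
    · exact one_mem S
    · exact zero_mem S
  have hδ₂S : δ₂ ∈ S := sub_mem (mul_mem hεS hδS) (one_mem S)
  choose cB hcB using hB₂S
  obtain ⟨cδ, hcδ⟩ := hδ₂S
  let c := cδ + ∑ i, ∑ j, cB i j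
  have hcB' : ∀ i j n, v ((B₂ i j).coeff n) ≤ α ^ c := by
    intro i j n
    refine (hcB i j n).trans (pow_le_pow_right' hα ?_)
    have h2 : cB i j ≤ ∑ j, cB i j :=
      Finset.single_le_sum (f := fun j => cB i j) (by simp) (Finset.mem_univ j)
    have h3 : (∑ j, cB i j) ≤ ∑ i, ∑ j, cB i j :=
      Finset.single_le_sum (f := fun i => ∑ j, cB i j) (by simp) (Finset.mem_univ i)
    omega
  have hcδ' : ∀ n, v (δ₂.coeff n) ≤ α ^ c := fun n =>
    (hcδ n).trans (pow_le_pow_right' hα (by omega))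
  have heq : matFrob q k - k = δ₂ • k - B₂ * matFrob q k := by
    simp only [δ₂, B₂, sub_smul, sub_mul, one_smul, one_mul, Matrix.smul_mul, hBk, smul_smul]
    abel
  have hkneg : ∀ i j (n : ℤ), n < 0 → (k i j).coeff n = 0 := by
    intro i j n hn
    have := hk1 i j n hn.le
    rw [mat_coeff_sub, sub_eq_zero] at this
    rw [this, Matrix.one_apply]
    split_ifs
    · rw [HahnSeries.coeff_one, if_neg hn.ne]
    · rfl
  have main : ∀ n : ℕ, ∀ i j, v ((k i j).coeff (n : ℤ)) ≤ α ^ (c * n) := by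
    intro n
    induction n using Nat.strong_induction_on with
    | _ n ih =>
    intro i j
    have h1 : v ((k i j).coeff (n : ℤ) ^ q - (k i j).coeff (n : ℤ)) ≤ (α ^ (c * n)) ^ q := by
      have h2 : (k i j).coeff (n : ℤ) ^ q - (k i j).coeff (n : ℤ) =
          (δ₂ * k i j).coeff (n : ℤ) - ((B₂ * matFrob q k) i j).coeff (n : ℤ) := by
        have := congrArg (fun M => (M i j).coeff (n : ℤ)) heq
        simp only [mat_coeff_sub, matFrob_coeff hq0] at this
        exact this
      rw [h2]
      refine (v.map_sub _ _).trans (max_le ?_ ?_)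
      · refine coeff_mul_mem (leSub v _) _ _ _ fun a d had => ?_
        change v _ ≤ _
        by_cases ha : a ≤ 0
        · rw [hδ1 _ ha, zero_mul, map_zero]; exact zero_le
        by_cases hd : d < 0
        · rw [hkneg _ _ _ hd, mul_zero, map_zero]; exact zero_le
        lift d to ℕ using by omega
        rw [map_mul, ← pow_mul]
        refine (mul_le_mul' (hcδ' a) (ih d (by omega) i j)).trans ?_
        rw [← pow_add]
        refine pow_le_pow_right' hα ?_
        have : d + 1 ≤ n := by omega
        calc c + c * d = c * (d + 1) := by ring
          _ ≤ c * n := Nat.mul_le_mul_left _ this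
          _ ≤ c * n * q := Nat.le_mul_of_pos_right _ (by omega)
      · refine mat_coeff_mul_mem (leSub v _) _ _ _ _ _ fun m a d had => ?_
        change v _ ≤ _
        by_cases ha : a ≤ 0
        · rw [hB₂ _ _ _ ha, zero_mul, map_zero]; exact zero_le
        rw [matFrob_coeff hq0]
        by_cases hd : d < 0
        · rw [hkneg _ _ _ hd, zero_pow hq0, mul_zero, map_zero]; exact zero_le
        lift d to ℕ using by omega
        rw [map_mul, map_pow]
        refine (mul_le_mul' (hcB' i m a) (pow_le_pow_left' (ih d (by omega) m j) q)).trans ?_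
        rw [← pow_mul, ← pow_mul, ← pow_add]
        refine pow_le_pow_right' hα ?_
        have : d + 1 ≤ n := by omega
        calc c + c * d * q ≤ c * q + c * d * q := by
              gcongr; exact Nat.le_mul_of_pos_right _ (by omega)
          _ = c * (d + 1) * q := by ring
          _ ≤ c * n * q := by gcongr
    by_contra hcon
    push Not at hcon
    set u := (k i j).coeff (n : ℤ)
    have hu1 : 1 < v u := lt_of_le_of_lt (one_le_pow_of_one_le' hα _) hcon
    have h3 : v u < v (u ^ q) := by
      rw [map_pow]
      exact lt_self_pow₀ hu1 (by omega)
    rw [v.map_sub_eq_of_lt_left h3, map_pow] at h1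
    exact absurd h1 (not_le.2 (pow_lt_pow_left₀ hcon zero_le hq0))
  refine ⟨c, fun i j n => ?_⟩
  by_cases hn : n < 0
  · rw [hkneg _ _ _ hn, map_zero]; exact zero_le
  · lift n to ℕ using by omega
    have := main n i j
    rw [← zpow_natCast] at this
    exact_mod_cast this

theorem growth_y {K Γ : Type*} [Field K] [LinearOrderedCommGroupWithZero Γ] (v : Valuation K Γ)
    (α : Γ) (hα : 1 ≤ α) (hP2 : ∀ x : K, ∃ n : ℕ, v x ≤ α ^ n)
    {q : ℕ} (hq : 2 ≤ q) (hF : FrobAdd q K) {r : ℕ}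
    (b y f : Matrix (Fin r) (Fin r) (LaurentSeries K))
    (hyf : y * f = 1) (hb : ∀ i j n, v ((b i j).coeff n) ≤ 1) (hby : b * matFrob q y = y) :
    ∃ s c : ℕ, ∀ i j (n : ℤ), v ((y i j).coeff n) ≤ α ^ ((s : ℤ) + c * n) := by
  have hα0 : α ≠ 0 := (lt_of_lt_of_le zero_lt_one hα).ne'
  obtain ⟨g, k, l, hygk, hkl, ⟨lo, hi, hg⟩, hk1, hl1⟩ := factor y f hyf
  have hg' : ∃ s : ℕ, ∀ i j n, v ((g i j).coeff n) ≤ α ^ s := by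
    choose N hN using fun (i j : Fin r) (n : ℤ) => hP2 ((g i j).coeff n)
    refine ⟨∑ i, ∑ j, ∑ n ∈ Finset.Ico (-(lo : ℤ)) hi, N i j n, fun i j n => ?_⟩
    by_cases hn : n ∈ Finset.Ico (-(lo : ℤ)) hi
    · refine (hN i j n).trans (pow_le_pow_right' hα ?_)
      have h1 : N i j n ≤ ∑ n ∈ Finset.Ico (-(lo : ℤ)) hi, N i j n :=
        Finset.single_le_sum (f := fun n => N i j n) (by simp) hn
      have h2 : _ ≤ ∑ j, ∑ n ∈ Finset.Ico (-(lo : ℤ)) hi, N i j n :=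
        Finset.single_le_sum (f := fun j => ∑ n ∈ Finset.Ico (-(lo : ℤ)) hi, N i j n) (by simp)
          (Finset.mem_univ j)
      have h3 : _ ≤ ∑ i, ∑ j, ∑ n ∈ Finset.Ico (-(lo : ℤ)) hi, N i j n :=
        Finset.single_le_sum (f := fun i => ∑ j, ∑ n ∈ Finset.Ico (-(lo : ℤ)) hi, N i j n) (by simp)
          (Finset.mem_univ i)
      exact h1.trans (h2.trans h3)
    · rw [hg i j n, map_zero]
      · exact zero_le
      · rw [Finset.mem_Ico] at hn; omega
  obtain ⟨s, hs⟩ := hg'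
  obtain ⟨c, hc⟩ := growth_k v α hα hP2 hq hF b y f g k l hyf hb hby hygk hkl
    (fun i j => ⟨s, hs i j⟩) hk1 hl1
  refine ⟨s + c * lo, c, fun i j n => ?_⟩
  rw [hygk]
  refine mat_coeff_mul_mem (leSub v _) _ _ _ _ _ fun m a d had => ?_
  change v _ ≤ _
  by_cases ha : a < -(lo : ℤ)
  · rw [hg _ _ _ (Or.inl ha), zero_mul, map_zero]; exact zero_le
  · rw [map_mul]
    refine (mul_le_mul' (hs _ _ _) (hc _ _ _)).trans ?_
    rw [← zpow_natCast, ← zpow_add₀ hα0]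
    refine zpow_le_zpow_right₀ hα ?_
    push_cast
    have : (c : ℤ) * d ≤ c * (lo + n) := by gcongr; omega
    linarith

/-- Solutions of `b σ(y) = y` have integral coefficients. -/
theorem integral_y {K Γ : Type*} [Field K] [LinearOrderedCommGroupWithZero Γ] (v : Valuation K Γ)
    (α : Γ) (hα : 1 ≤ α) (hP2 : ∀ x : K, ∃ n : ℕ, v x ≤ α ^ n)
    {q : ℕ} (hq : 2 ≤ q) (hF : FrobAdd q K)
    (hP3 : ∀ x : K, (∀ j : ℕ, v x ^ (q ^ j) ≤ α) → v x ≤ 1) {r : ℕ}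
    (b b' y f : Matrix (Fin r) (Fin r) (LaurentSeries K)) (hbb : b' * b = 1)
    (hyf : y * f = 1) (hb : ∀ i j n, v ((b i j).coeff n) ≤ 1)
    (hb' : ∀ i j n, v ((b' i j).coeff n) ≤ 1) (hby : b * matFrob q y = y) :
    ∀ i j n, v ((y i j).coeff n) ≤ 1 := by
  have hq0 : q ≠ 0 := hF.1
  have hα0 : α ≠ 0 := (lt_of_lt_of_le zero_lt_one hα).ne'
  obtain ⟨s, c, hsc⟩ := growth_y v α hα hP2 hq hF b y f hyf hb hby
  obtain ⟨N, hN⟩ := exists_low b'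
  have hσy : matFrob q y = b' * y := by
    rw [← hby, ← mul_assoc, hbb, one_mul, hby]
  have key : ∀ t : ℕ, ∀ i j (n : ℤ),
      v ((matFrob (q ^ t) y i j).coeff n) ≤ α ^ ((s : ℤ) + c * (n + N * t)) := by
    intro t
    induction t with
    | zero =>
      intro i j n
      rw [matFrob_coeff (by simp)]
      simpa using hsc i j n
    | succ t ih =>
      intro i j n
      rw [← matFrob_comp hq0, hσy, matFrob_mul (hF.pow t)]
      refine mat_coeff_mul_mem (leSub v _) _ _ _ _ _ fun m a d had => ?_
      change v _ ≤ _
      rw [matFrob_coeff (pow_ne_zero _ hq0)]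
      by_cases ha : a < -(N : ℤ)
      · rw [hN _ _ _ ha, zero_pow (pow_ne_zero _ hq0), zero_mul, map_zero]; exact zero_le
      · rw [map_mul, map_pow]
        refine (mul_le_mul' (pow_le_one' (hb' _ _ _) _) (ih _ _ _)).trans ?_
        rw [one_mul]
        refine zpow_le_zpow_right₀ hα ?_
        push_cast
        have : (c : ℤ) * (d + N * t) ≤ c * (n + N * (t + 1)) := by
          refine mul_le_mul_of_nonneg_left ?_ (Int.natCast_nonneg c)
          have : (N : ℤ) * (t + 1) = N * t + N := by ring
          omega
        linarith
  intro i j n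
  refine hP3 _ fun u => ?_
  obtain ⟨m, hm⟩ : ∃ m : ℕ, (s : ℤ) + c * (n + N * ((m + u : ℕ) : ℤ)) ≤ (q : ℤ) ^ m := by
    obtain ⟨C, hC⟩ : ∃ C : ℕ, (s : ℤ) + c * (n + N * u) ≤ C := ⟨_, Int.self_le_toNat _⟩
    have h1 : ∃ m : ℕ, C + (c * N) * m ≤ 2 ^ m := by
      refine ⟨3 * (C + c * N + 2), ?_⟩
      obtain ⟨D, hD⟩ : ∃ D, D = c * N := ⟨_, rfl⟩
      rw [← hD]
      obtain ⟨x, hx⟩ : ∃ x, x = C + D + 2 := ⟨_, rfl⟩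
      rw [← hx]
      have h3 : x + 1 ≤ 2 ^ x := Nat.lt_two_pow_self
      have h4 : D ≤ x := by omega
      have h5 : C ≤ x := by omega
      calc C + D * (3 * x) ≤ x + x * (3 * x) := by gcongr
        _ ≤ (x + 1) ^ 3 := by nlinarith [pow_nonneg (Nat.zero_le x) 3]
        _ ≤ (2 ^ x) ^ 3 := by gcongr
        _ = 2 ^ (3 * x) := by rw [← pow_mul, mul_comm]
    obtain ⟨m, hm⟩ := h1
    refine ⟨m, ?_⟩
    have h2 : (2 : ℤ) ^ m ≤ (q : ℤ) ^ m := by gcongr; exact_mod_cast hq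
    refine le_trans ?_ h2
    have h3 : ((C + (c * N) * m : ℕ) : ℤ) ≤ ((2 ^ m : ℕ) : ℤ) := by exact_mod_cast hm
    push_cast at h3 ⊢
    linarith
  have h1 := key (m + u) i j n
  rw [matFrob_coeff (pow_ne_zero _ hq0), map_pow] at h1
  have h2 := h1.trans (zpow_le_zpow_right₀ hα hm)
  have h3 : α ^ ((q : ℤ) ^ m) = α ^ (q ^ m) := by
    rw [← zpow_natCast]; push_cast; rfl
  rw [h3, add_comm, pow_add, pow_mul] at h2
  exact le_of_pow_le_pow_left₀ (pow_ne_zero _ hq0) zero_le h2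

/-! ## Normalization -/

theorem prod_sub_fin {F K : Type*} [Field F] [Fintype F] [Field K] (ι : F →+* K) (u : K) :
    ∏ c : F, (u - ι c) = u ^ Fintype.card F - u := by
  have h0 : (Polynomial.X ^ Fintype.card F - Polynomial.X : Polynomial F).Monic := by
    refine Polynomial.monic_X_pow_sub ?_
    rw [Polynomial.degree_X]
    exact_mod_cast Fintype.one_lt_card
  have h1 := Polynomial.prod_multiset_X_sub_C_of_monic_of_roots_card_eq h0 (by
    rw [FiniteField.roots_X_pow_card_sub_X,
      FiniteField.X_pow_card_sub_X_natDegree_eq F Fintype.one_lt_card]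
    rfl)
  rw [FiniteField.roots_X_pow_card_sub_X] at h1
  have h2 := congrArg (Polynomial.eval₂ ι u) h1
  have h3 : (Multiset.map (fun a : F => Polynomial.X - Polynomial.C a) Finset.univ.val).prod =
      ∏ c : F, (Polynomial.X - Polynomial.C c) := rfl
  rw [h3, Polynomial.eval₂_finsetProd] at h2
  simpa using h2

theorem val_fin_le {F K Γ : Type*} [Field F] [Fintype F] [Field K]
    [LinearOrderedCommGroupWithZero Γ] (v : Valuation K Γ) (ι : F →+* K) (c : F) :
    v (ι c) ≤ 1 := by
  by_contra h
  push Not at h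
  have h1 := lt_self_pow₀ h (Fintype.one_lt_card (α := F))
  rw [← map_pow, ← map_pow, FiniteField.pow_card] at h1
  exact lt_irrefl _ h1

theorem fin_eq_zero {F K Γ : Type*} [Field F] [Fintype F] [Field K]
    [LinearOrderedCommGroupWithZero Γ] (v : Valuation K Γ) (ι : F →+* K) (c : F)
    (h : v (ι c) < 1) : c = 0 := by
  by_contra hc
  have h1 : v (ι c) * v (ι c⁻¹) < 1 := mul_lt_one_of_lt_of_le h (val_fin_le v ι c⁻¹)
  rw [← map_mul, ← map_mul, mul_inv_cancel₀ hc, map_one, map_one] at h1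
  exact lt_irrefl _ h1

theorem exists_fin {F K Γ : Type*} [Field F] [Fintype F] [Field K]
    [LinearOrderedCommGroupWithZero Γ] (v : Valuation K Γ) (ι : F →+* K) (u : K)
    (h : v (u ^ Fintype.card F - u) < 1) : ∃ c : F, v (u - ι c) < 1 := by
  by_contra hc
  push Not at hc
  rw [← prod_sub_fin ι, map_prod] at h
  have : (1 : Γ) ≤ ∏ c : F, v (u - ι c) := Finset.one_le_prod'' fun c => hc c
  exact absurd h (not_lt.2 this)

theorem mat_lt {K Γ : Type*} [Field K] [LinearOrderedCommGroupWithZero Γ] (v : Valuation K Γ)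
    {r : ℕ} (M N : Matrix (Fin r) (Fin r) (LaurentSeries K))
    (hM : ∀ i j n, v ((M i j).coeff n) < 1) (hN : ∀ i j n, v ((N i j).coeff n) ≤ 1) :
    ∀ i j n, v (((M * N) i j).coeff n) < 1 := fun i j n =>
  mat_coeff_mul_mem (ltSub v) M N i j n fun l a c _ => by
    change v _ < 1
    rw [map_mul]
    exact mul_lt_one_of_lt_of_le (hM _ _ _) (hN _ _ _)

theorem mat_lt' {K Γ : Type*} [Field K] [LinearOrderedCommGroupWithZero Γ] (v : Valuation K Γ)
    {r : ℕ} (M N : Matrix (Fin r) (Fin r) (LaurentSeries K))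
    (hM : ∀ i j n, v ((M i j).coeff n) ≤ 1) (hN : ∀ i j n, v ((N i j).coeff n) < 1) :
    ∀ i j n, v (((M * N) i j).coeff n) < 1 := fun i j n =>
  mat_coeff_mul_mem (ltSub v) M N i j n fun l a c _ => by
    change v _ < 1
    rw [map_mul, mul_comm]
    exact mul_lt_one_of_lt_of_le (hN _ _ _) (hM _ _ _)

theorem mat_one_le {K Γ : Type*} [Field K] [LinearOrderedCommGroupWithZero Γ] (v : Valuation K Γ)
    {r : ℕ} (i j : Fin r) (n : ℤ) :
    v (((1 : Matrix (Fin r) (Fin r) (LaurentSeries K)) i j).coeff n) ≤ 1 := by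
  rw [Matrix.one_apply]
  split_ifs
  · rw [HahnSeries.coeff_one]; split_ifs <;> simp
  · simp

theorem mat_le_of_sub_one {K Γ : Type*} [Field K] [LinearOrderedCommGroupWithZero Γ]
    (v : Valuation K Γ) {r : ℕ} (M : Matrix (Fin r) (Fin r) (LaurentSeries K))
    (hM : ∀ i j n, v (((M - 1) i j).coeff n) < 1) (i j : Fin r) (n : ℤ) :
    v ((M i j).coeff n) ≤ 1 := by
  have h : M = (M - 1) + 1 := by abel
  rw [h, Matrix.add_apply, HahnSeries.coeff_add]
  exact (v.map_add _ _).trans (max_le (hM i j n).le (mat_one_le v i j n))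

theorem normalize {F K Γ : Type*} [Field F] [Fintype F] [Field K]
    [LinearOrderedCommGroupWithZero Γ] (v : Valuation K Γ) (ι : F →+* K)
    {q : ℕ} (hcard : Fintype.card F = q) (hF : FrobAdd q K) {r : ℕ}
    (b y f : Matrix (Fin r) (Fin r) (LaurentSeries K)) (hyf : y * f = 1)
    (hby : b * matFrob q y = y)
    (hy : ∀ i j n, v ((y i j).coeff n) ≤ 1) (hf : ∀ i j n, v ((f i j).coeff n) ≤ 1)
    (hb : ∀ i j n, v (((b - 1) i j).coeff n) < 1) :
    ∃ y' f' : Matrix (Fin r) (Fin r) (LaurentSeries K), y' * f' = 1 ∧ b * matFrob q y' = y' ∧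
      (∀ i j n, v (((y' - 1) i j).coeff n) < 1) ∧ (∀ i j n, v (((f' - 1) i j).coeff n) < 1) := by
  have hq0 : q ≠ 0 := hF.1
  have hfy : f * y = 1 := mul_eq_one_comm.1 hyf
  have hσyf : matFrob q y * matFrob q f = 1 := by rw [← matFrob_mul hF, hyf, matFrob_one hF]
  have hbf : b = y * matFrob q f := by
    rw [← hby, mul_assoc, hσyf, mul_one]
  have hσf : matFrob q f = f * b := by rw [hbf, ← mul_assoc, hfy, one_mul]
  have hσy1 : ∀ i j n, v ((matFrob q y i j).coeff n) ≤ 1 := fun i j n => by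
    rw [matFrob_coeff hq0, map_pow]; exact pow_le_one' (hy _ _ _) _
  have h1 : ∀ i j n, v ((y i j).coeff n ^ q - (y i j).coeff n) < 1 := by
    intro i j n
    have e1 : y - matFrob q y = (b - 1) * matFrob q y := by rw [sub_mul, hby, one_mul]
    have := mat_lt v _ _ hb hσy1 i j n
    rw [← e1, mat_coeff_sub, matFrob_coeff hq0, Valuation.map_sub_swap] at this
    exact this
  have h2 : ∀ i j n, v ((f i j).coeff n ^ q - (f i j).coeff n) < 1 := by
    intro i j n
    have e1 : matFrob q f - f = f * (b - 1) := by rw [mul_sub, ← hσf, mul_one]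
    have := mat_lt' v _ _ hf hb i j n
    rw [← e1, mat_coeff_sub, matFrob_coeff hq0] at this
    exact this
  have hχ : ∀ u : K, ∃ c : F, (v (u ^ q - u) < 1 → v (u - ι c) < 1) ∧ (u = 0 → c = 0) := by
    intro u
    by_cases h0 : u = 0
    · exact ⟨0, fun _ => by simp [h0], fun _ => rfl⟩
    by_cases hu : v (u ^ q - u) < 1
    · obtain ⟨c, hc⟩ := exists_fin v ι u (by rw [hcard]; exact hu)
      exact ⟨c, fun _ => hc, fun h => absurd h h0⟩
    · exact ⟨0, fun h => absurd h hu, fun _ => rfl⟩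
  choose χ hχ1 hχ0 using hχ
  let X : ZeroHom K F := ⟨χ, hχ0 0 rfl⟩
  let C : Matrix (Fin r) (Fin r) (LaurentSeries F) := y.map fun s => s.map X
  let D : Matrix (Fin r) (Fin r) (LaurentSeries F) := f.map fun s => s.map X
  let c := C.map (lmap ι)
  let d := D.map (lmap ι)
  have hyc : ∀ i j n, v (((y - c) i j).coeff n) < 1 := fun i j n => hχ1 _ (h1 i j n)
  have hfd : ∀ i j n, v (((f - d) i j).coeff n) < 1 := fun i j n => hχ1 _ (h2 i j n)
  have hc1 : ∀ i j n, v ((c i j).coeff n) ≤ 1 := fun i j n => val_fin_le v ι _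
  have hd1 : ∀ i j n, v ((d i j).coeff n) ≤ 1 := fun i j n => val_fin_le v ι _
  have hσfix : ∀ M : Matrix (Fin r) (Fin r) (LaurentSeries F),
      matFrob q (M.map (lmap ι)) = M.map (lmap ι) := by
    intro M
    ext i j n
    rw [matFrob_coeff hq0, Matrix.map_apply, lmap_coeff, ← map_pow, ← hcard, FiniteField.pow_card]
  have hCD : C * D = 1 := by
    rw [← sub_eq_zero]
    ext i j n
    refine fin_eq_zero v ι _ ?_
    have e1 : (C * D - 1).map (lmap ι) = -((y - c) * d + y * (f - d)) := by
      rw [map_lmap_sub, map_lmap_mul, map_lmap_one]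
      change c * d - 1 = _
      rw [sub_mul, mul_sub, hyf]; abel
    have e2 : ι (((C * D - 1) i j).coeff n) = (((C * D - 1).map (lmap ι)) i j).coeff n := rfl
    rw [e2, e1, Matrix.neg_apply, HahnSeries.coeff_neg, Valuation.map_neg, Matrix.add_apply,
      HahnSeries.coeff_add]
    exact (v.map_add _ _).trans_lt (max_lt (mat_lt v _ _ hyc hd1 i j n)
      (mat_lt' v _ _ hy hfd i j n))
  have hcd : c * d = 1 := by
    change C.map (lmap ι) * D.map (lmap ι) = 1
    rw [← map_lmap_mul, hCD, map_lmap_one]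
  have hdc : d * c = 1 := mul_eq_one_comm.1 hcd
  refine ⟨y * d, c * f, ?_, ?_, ?_, ?_⟩
  · calc y * d * (c * f) = y * (d * c) * f := by simp only [mul_assoc]
      _ = 1 := by rw [hdc, mul_one, hyf]
  · rw [matFrob_mul hF, ← mul_assoc, hby, hσfix]
  · have : y * d - 1 = (y - c) * d := by rw [sub_mul, hcd]
    rw [this]
    exact mat_lt v _ _ hyc hd1
  · have : c * f - 1 = c * (f - d) := by rw [mul_sub, hcd]
    rw [this]
    exact mat_lt' v _ _ hc1 hfd

/-! ## Comparison -/

/-- The partial products `b σ(b) ⋯ σ^(t-1)(b)`. -/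
def prodFrob (q : ℕ) {B : Type*} [CommRing B] {r : ℕ}
    (b : Matrix (Fin r) (Fin r) (LaurentSeries B)) : ℕ → Matrix (Fin r) (Fin r) (LaurentSeries B)
  | 0 => 1
  | t + 1 => prodFrob q b t * matFrob (q ^ t) b

theorem prodFrob_map {q : ℕ} (hq : q ≠ 0) {B C : Type*} [CommRing B] [CommRing C] (φ : B →+* C)
    {r : ℕ} (b : Matrix (Fin r) (Fin r) (LaurentSeries B)) (t : ℕ) :
    (prodFrob q b t).map (lmap φ) = prodFrob q (b.map (lmap φ)) t := by
  induction t with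
  | zero => exact map_lmap_one φ
  | succ t ih => rw [prodFrob, prodFrob, map_lmap_mul, ih, matFrob_lmap (pow_ne_zero _ hq)]

theorem prodFrob_eq {q : ℕ} {B : Type*} [CommRing B] (hF : FrobAdd q B) {r : ℕ}
    (b y f : Matrix (Fin r) (Fin r) (LaurentSeries B)) (hyf : y * f = 1)
    (hby : b * matFrob q y = y) (t : ℕ) : prodFrob q b t = y * matFrob (q ^ t) f := by
  have hfy : f * y = 1 := mul_eq_one_comm.1 hyf
  have hσyf : matFrob q y * matFrob q f = 1 := by rw [← matFrob_mul hF, hyf, matFrob_one hF]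
  have hbf : b = y * matFrob q f := by
    rw [← hby, mul_assoc, hσyf, mul_one]
  induction t with
  | zero =>
    have : matFrob (q ^ 0) f = f := by
      ext i j n; rw [matFrob_coeff (by simp)]; simp
    rw [this, hyf, prodFrob]
  | succ t ih =>
    rw [prodFrob, ih]
    conv_lhs => rw [hbf, matFrob_mul (hF.pow t), matFrob_comp hF.1]
    calc y * matFrob (q ^ t) f * (matFrob (q ^ t) y * matFrob (q ^ (t + 1)) f)
        = y * (matFrob (q ^ t) f * matFrob (q ^ t) y) * matFrob (q ^ (t + 1)) f := by
          simp only [mul_assoc]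
      _ = _ := by rw [← matFrob_mul (hF.pow t), hfy, matFrob_one (hF.pow t), mul_one]

theorem decay {K Γ : Type*} [Field K] [LinearOrderedCommGroupWithZero Γ] (v : Valuation K Γ)
    {q : ℕ} (hq : 2 ≤ q) (a : K) (ha1 : v a < 1)
    (hP3 : ∀ x : K, (∀ j : ℕ, v x ^ (q ^ j) * v a ≤ 1) → v x ≤ 1) (u : K) (hu : v u < 1) (s : ℕ) :
    ∃ T : ℕ, ∀ t, T ≤ t → v u ^ (q ^ t) ≤ v a ^ s := by
  have hq0 : q ≠ 0 := by omega
  by_cases h0 : u = 0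
  · refine ⟨0, fun t _ => ?_⟩
    rw [h0, map_zero, zero_pow (pow_ne_zero _ hq0)]; exact zero_le
  have hv0 : v u ≠ 0 := (Valuation.ne_zero_iff v).2 h0
  have h1 : ∃ j : ℕ, v u ^ (q ^ j) ≤ v a := by
    by_contra hcon
    push Not at hcon
    have := hP3 u⁻¹ fun j => by
      rw [map_inv₀, inv_pow, inv_mul_le_iff₀ (zero_lt_iff.2 (pow_ne_zero _ hv0)), mul_one]
      exact (hcon j).le
    rw [map_inv₀, inv_le_one₀ (zero_lt_iff.2 hv0)] at this
    exact absurd hu (not_lt.2 this)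
  obtain ⟨j, hj⟩ := h1
  refine ⟨j + s, fun t ht => ?_⟩
  obtain ⟨m, rfl⟩ : ∃ m, t = j + m := ⟨t - j, by omega⟩
  rw [pow_add, pow_mul]
  refine (pow_le_pow_left' hj _).trans (pow_le_pow_right_of_le_one' ha1.le ?_)
  have : m < q ^ m := Nat.lt_pow_self hq
  omega

theorem compare {K Γ : Type*} [Field K] [LinearOrderedCommGroupWithZero Γ] (v : Valuation K Γ)
    {q : ℕ} (hq : 2 ≤ q) (hF : FrobAdd q K) (a : K) (ha0 : a ≠ 0) (ha1 : v a < 1)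
    (hP2 : ∀ x : K, ∃ n : ℕ, v x * v a ^ n ≤ 1)
    (hP3 : ∀ x : K, (∀ j : ℕ, v x ^ (q ^ j) * v a ≤ 1) → v x ≤ 1) {r : ℕ}
    (b y f : Matrix (Fin r) (Fin r) (LaurentSeries K)) (hyf : y * f = 1)
    (hby : b * matFrob q y = y)
    (hy : ∀ i j n, v (((y - 1) i j).coeff n) < 1) (hf : ∀ i j n, v (((f - 1) i j).coeff n) < 1)
    (i j : Fin r) (n : ℤ) (x : K)
    (hx : ∀ t : ℕ, v (x - (prodFrob q b t i j).coeff n) ≤ v a ^ t) : x = (y i j).coeff n := by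
  have hq0 : q ≠ 0 := hF.1
  have hy1 := mat_le_of_sub_one v y hy
  obtain ⟨N, hN⟩ := exists_low y
  obtain ⟨M, hM⟩ := exists_low (f - 1)
  have hva0 : v a ≠ 0 := (Valuation.ne_zero_iff v).2 ha0
  have hs : ∀ s : ℕ, v (x - (y i j).coeff n) ≤ v a ^ s := by
    intro s
    choose T hT using fun (l : Fin r) (d : ℤ) =>
      decay v hq a ha1 hP3 (((f - 1) l j).coeff d) (hf l j d) s
    let t := s + ∑ l, ∑ d ∈ Finset.Icc (-(M : ℤ)) (n + N), T l d
    have e1 : prodFrob q b t - y = y * matFrob (q ^ t) (f - 1) := by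
      rw [prodFrob_eq hF b y f hyf hby, matFrob_sub (hF.pow t), matFrob_one (hF.pow t), mul_sub,
        mul_one]
    have h1 : v (((prodFrob q b t - y) i j).coeff n) ≤ v a ^ s := by
      rw [e1]
      refine mat_coeff_mul_mem (leSub v _) _ _ _ _ _ fun l c d hcd => ?_
      change v _ ≤ _
      rw [matFrob_coeff (pow_ne_zero _ hq0)]
      by_cases hc : c < -(N : ℤ)
      · rw [hN _ _ _ hc, zero_mul, map_zero]; exact zero_le
      by_cases hd : d < -(M : ℤ)
      · rw [hM _ _ _ hd, zero_pow (pow_ne_zero _ hq0), mul_zero, map_zero]; exact zero_le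
      have hmem : d ∈ Finset.Icc (-(M : ℤ)) (n + N) := by rw [Finset.mem_Icc]; omega
      rw [map_mul, map_pow]
      refine (mul_le_mul' (hy1 _ _ _) (hT l d t ?_)).trans (by rw [one_mul])
      have h2 : T l d ≤ ∑ d ∈ Finset.Icc (-(M : ℤ)) (n + N), T l d :=
        Finset.single_le_sum (f := fun d => T l d) (by simp) hmem
      have h3 : _ ≤ ∑ l, ∑ d ∈ Finset.Icc (-(M : ℤ)) (n + N), T l d :=
        Finset.single_le_sum (f := fun l => ∑ d ∈ Finset.Icc (-(M : ℤ)) (n + N), T l d) (by simp)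
          (Finset.mem_univ l)
      exact (h2.trans h3).trans (Nat.le_add_left _ _)
    have h2 : v (x - (prodFrob q b t i j).coeff n) ≤ v a ^ s :=
      (hx t).trans (pow_le_pow_right_of_le_one' ha1.le (Nat.le_add_right _ _))
    have e2 : x - (y i j).coeff n =
        (x - (prodFrob q b t i j).coeff n) + ((prodFrob q b t - y) i j).coeff n := by
      rw [mat_coeff_sub]; ring
    rw [e2]
    exact (v.map_add _ _).trans (max_le h2 h1)
  by_contra hne
  have hd0 : x - (y i j).coeff n ≠ 0 := sub_ne_zero.2 hne
  have hvd0 := (Valuation.ne_zero_iff v).2 hd0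
  obtain ⟨m, hm⟩ := hP2 (x - (y i j).coeff n)⁻¹
  rw [map_inv₀, inv_mul_le_iff₀ (zero_lt_iff.2 hvd0), mul_one] at hm
  have h3 := hm.trans (hs (m + 1))
  rw [pow_succ] at h3
  have h4 : v a ^ m * v a < v a ^ m * 1 :=
    mul_lt_mul_of_pos_left ha1 (zero_lt_iff.2 (pow_ne_zero _ hva0))
  rw [mul_one] at h4
  exact absurd h3 (not_le.2 h4)

/-! ## Normalized solutions at a point -/

theorem point_norm {F K Γ : Type*} [Field F] [Fintype F] [Field K]
    [LinearOrderedCommGroupWithZero Γ] (v : Valuation K Γ) (ι : F →+* K)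
    {q : ℕ} (hcard : Fintype.card F = q) (hq : 2 ≤ q) (hF : FrobAdd q K)
    (a : K) (ha0 : a ≠ 0) (ha1 : v a < 1)
    (hP2 : ∀ x : K, ∃ n : ℕ, v x * v a ^ n ≤ 1)
    (hP3 : ∀ x : K, (∀ j : ℕ, v x ^ (q ^ j) * v a ≤ 1) → v x ≤ 1) {r : ℕ}
    (b b' y f : Matrix (Fin r) (Fin r) (LaurentSeries K)) (hbb : b' * b = 1) (hyf : y * f = 1)
    (hby : b * matFrob q y = y)
    (hb : ∀ i j n, v (((b - 1) i j).coeff n) < 1)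
    (hb' : ∀ i j n, v (((b' - 1) i j).coeff n) < 1) :
    ∃ y' f' : Matrix (Fin r) (Fin r) (LaurentSeries K), y' * f' = 1 ∧ b * matFrob q y' = y' ∧
      (∀ i j n, v (((y' - 1) i j).coeff n) < 1) ∧ (∀ i j n, v (((f' - 1) i j).coeff n) < 1) := by
  have hva : 0 < v a := zero_lt_iff.2 ((Valuation.ne_zero_iff v).2 ha0)
  have hα : 1 ≤ (v a)⁻¹ := (one_le_inv₀ hva).2 ha1.le
  have hP2' : ∀ x : K, ∃ n : ℕ, v x ≤ (v a)⁻¹ ^ n := fun x => by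
    obtain ⟨n, hn⟩ := hP2 x
    refine ⟨n, ?_⟩
    rw [inv_pow, ← one_div, le_div_iff₀ (pow_pos hva n)]
    exact hn
  have hP3' : ∀ x : K, (∀ j : ℕ, v x ^ (q ^ j) ≤ (v a)⁻¹) → v x ≤ 1 := fun x hx =>
    hP3 x fun j => by
      have := hx j
      rwa [← one_div, le_div_iff₀ hva] at this
  have hb1 := mat_le_of_sub_one v b hb
  have hb'1 := mat_le_of_sub_one v b' hb'
  have hfy : f * y = 1 := mul_eq_one_comm.1 hyf
  have hb'b : b * b' = 1 := mul_eq_one_comm.1 hbb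
  have hσyf : matFrob q y * matFrob q f = 1 := by rw [← matFrob_mul hF, hyf, matFrob_one hF]
  have hbf : b = y * matFrob q f := by
    rw [← hby, mul_assoc, hσyf, mul_one]
  have hσf : matFrob q f = f * b := by rw [hbf, ← mul_assoc, hfy, one_mul]
  have hy := integral_y v _ hα hP2' hq hF hP3' b b' y f hbb hyf hb1 hb'1 hby
  have hf := integral_y v _ hα hP2' hq hF hP3' b'.transpose b.transpose f.transpose y.transpose
    (by rw [← Matrix.transpose_mul, hbb, Matrix.transpose_one])
    (by rw [← Matrix.transpose_mul, hyf, Matrix.transpose_one])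
    (fun i j n => hb'1 j i n) (fun i j n => hb1 j i n) (by
      change b'.transpose * (matFrob q f).transpose = _
      rw [← Matrix.transpose_mul, hσf, mul_assoc, hb'b, mul_one])
  exact normalize v ι hcard hF b y f hyf hby hy (fun i j n => hf j i n) hb

/-! ## Lifting to `R` -/

theorem prodFrob_step {R : Type*} [CommRing R] (m : Ideal R) {q : ℕ} (hq : 2 ≤ q)
    (hF : FrobAdd q R) {r : ℕ} (b : Matrix (Fin r) (Fin r) (LaurentSeries R))
    (hb : ∀ i j n, ((b - 1) i j).coeff n ∈ m) (t : ℕ) (i j : Fin r) (n : ℤ) :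
    (prodFrob q b (t + 1) i j).coeff n - (prodFrob q b t i j).coeff n ∈ m ^ t := by
  have e1 : prodFrob q b (t + 1) - prodFrob q b t = prodFrob q b t * matFrob (q ^ t) (b - 1) := by
    rw [matFrob_sub (hF.pow t), matFrob_one (hF.pow t), mul_sub, mul_one, prodFrob]
  rw [← mat_coeff_sub, e1]
  refine mat_coeff_mul_mem (m ^ t).toAddSubmonoid _ _ _ _ _ fun l c d _ => ?_
  change _ ∈ m ^ t
  refine Ideal.mul_mem_left _ _ ?_
  rw [matFrob_coeff (pow_ne_zero _ hF.1)]
  exact Ideal.pow_le_pow_right (Nat.lt_pow_self hq).le (Ideal.pow_mem_pow (hb _ _ _) _)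

theorem prodFrob_cauchy {R : Type*} [CommRing R] (m : Ideal R) {q : ℕ} (hq : 2 ≤ q)
    (hF : FrobAdd q R) {r : ℕ} (b : Matrix (Fin r) (Fin r) (LaurentSeries R))
    (hb : ∀ i j n, ((b - 1) i j).coeff n ∈ m) (s t : ℕ) (hst : s ≤ t) (i j : Fin r) (n : ℤ) :
    (prodFrob q b t i j).coeff n - (prodFrob q b s i j).coeff n ∈ m ^ s := by
  induction t, hst using Nat.le_induction with
  | base => simp
  | succ t hst ih =>
    have h1 := Ideal.pow_le_pow_right hst (prodFrob_step m hq hF b hb t i j n)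
    have := add_mem h1 ih
    rwa [sub_add_sub_cancel] at this

theorem val_pow_le {R K Γ : Type*} [CommRing R] [Field K] [LinearOrderedCommGroupWithZero Γ]
    (v : Valuation K Γ) (φ : R →+* K) (m : Ideal R) (a : K) (h1 : ∀ d, v (φ d) ≤ 1)
    (hm : ∀ d ∈ m, v (φ d) ≤ v a) (t : ℕ) : ∀ d ∈ m ^ t, v (φ d) ≤ v a ^ t := by
  let J : ℕ → Ideal R := fun t =>
    { carrier := {d | v (φ d) ≤ v a ^ t}
      zero_mem' := by simp
      add_mem' := by
        intro x y hx hy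
        change v (φ (x + y)) ≤ _
        rw [map_add]
        exact (v.map_add _ _).trans (max_le hx hy)
      smul_mem' := by
        intro c x hx
        change v (φ (c * x)) ≤ _
        rw [map_mul, map_mul]
        exact (mul_le_mul' (h1 c) hx).trans (by rw [one_mul]) }
  have : ∀ t, m ^ t ≤ J t := by
    intro t
    induction t with
    | zero => intro d _; change v (φ d) ≤ v a ^ 0; simpa using h1 d
    | succ t ih =>
      rw [pow_succ, Ideal.mul_le]
      intro x hx y hy
      change v (φ (x * y)) ≤ v a ^ (t + 1)
      rw [map_mul, map_mul, pow_succ]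
      exact mul_le_mul' (ih hx) (hm y hy)
  exact this t

theorem lift_sol {R : Type*} [CommRing R] (m : Ideal R) [IsAdicComplete m R]
    {q : ℕ} (hq : 2 ≤ q) (hF : FrobAdd q R)
    {I : Type*} [Finite I] (K : I → Type*) [∀ i, Field (K i)] (φ : ∀ i, R →+* K i)
    (hFK : ∀ i, FrobAdd q (K i))
    (hinj : ∀ x, (∀ i, φ i x = 0) → x = 0) (V : ∀ i, ValuationSubring (K i)) (a : ∀ i, K i)
    (ha0 : ∀ i, a i ≠ 0) (ha1 : ∀ i, (V i).valuation (a i) < 1)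
    (hd1 : ∀ i d, (V i).valuation (φ i d) ≤ 1)
    (hdm : ∀ i, ∀ d ∈ m, (V i).valuation (φ i d) ≤ (V i).valuation (a i))
    (hP2 : ∀ i, ∀ x : K i, ∃ n : ℕ, (V i).valuation x * (V i).valuation (a i) ^ n ≤ 1)
    (hP3 : ∀ i, ∀ x : K i, (∀ j : ℕ, (V i).valuation x ^ (q ^ j) * (V i).valuation (a i) ≤ 1) →
      (V i).valuation x ≤ 1) {r : ℕ}
    (b : Matrix (Fin r) (Fin r) (LaurentSeries R)) (hb : ∀ i j n, ((b - 1) i j).coeff n ∈ m)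
    (y f : ∀ i, Matrix (Fin r) (Fin r) (LaurentSeries (K i))) (hyf : ∀ i, y i * f i = 1)
    (hby : ∀ i, b.map (lmap (φ i)) * matFrob q (y i) = y i)
    (hy : ∀ k i j n, (V k).valuation (((y k - 1) i j).coeff n) < 1)
    (hf : ∀ k i j n, (V k).valuation (((f k - 1) i j).coeff n) < 1) :
    ∃ X : Matrix (Fin r) (Fin r) (LaurentSeries R), ∀ i, X.map (lmap (φ i)) = y i := by
  have hlim : ∀ (i j : Fin r) (n : ℤ), ∃ x : R, ∀ t : ℕ,
      x - (prodFrob q b t i j).coeff n ∈ m ^ t := by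
    intro i j n
    obtain ⟨L, hL⟩ := IsPrecomplete.prec (I := m) (M := R) inferInstance
      (f := fun t => (prodFrob q b t i j).coeff n) (by
        intro s t hst
        rw [SModEq.sub_mem, smul_eq_mul, Ideal.mul_top, ← neg_sub]
        exact neg_mem (prodFrob_cauchy m hq hF b hb s t hst i j n))
    refine ⟨L, fun t => ?_⟩
    have := hL t
    rw [SModEq.sub_mem, smul_eq_mul, Ideal.mul_top] at this
    rw [← neg_sub]
    exact neg_mem this
  choose x hx using hlim
  have hxy : ∀ k i j n, φ k (x i j n) = ((y k) i j).coeff n := by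
    intro k i j n
    refine compare (V k).valuation hq (hFK k) (a k) (ha0 k) (ha1 k) (hP2 k) (hP3 k)
      (b.map (lmap (φ k))) (y k) (f k) (hyf k) (hby k) (hy k) (hf k) i j n _ fun t => ?_
    have h1 := val_pow_le (V k).valuation (φ k) m (a k) (hd1 k) (hdm k) t _ (hx i j n t)
    rw [map_sub] at h1
    rw [← prodFrob_map hF.1]
    exact h1
  choose N hN using fun k => exists_low (y k)
  cases nonempty_fintype I
  have hlow : ∀ i j, ∀ n : ℤ, n < -((∑ k, N k : ℕ) : ℤ) → x i j n = 0 := by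
    intro i j n hn
    refine hinj _ fun k => ?_
    rw [hxy]
    refine hN k i j n ?_
    have : N k ≤ ∑ k, N k := Finset.single_le_sum (f := N) (by simp) (Finset.mem_univ k)
    omega
  refine ⟨fun i j => HahnSeries.ofSuppBddBelow (x i j) ⟨-((∑ k, N k : ℕ) : ℤ), ?_⟩, ?_⟩
  · intro n hn
    by_contra hlt
    exact hn (hlow i j n (not_le.1 hlt))
  · intro k
    ext i j n
    exact hxy k i j n

/-- Matrices over `R((z))` are determined by their images at the points. -/
theorem mat_ext {R : Type*} [CommRing R] {I : Type*} (K : I → Type*) [∀ i, Field (K i)]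
    (φ : ∀ i, R →+* K i) (hinj : ∀ x, (∀ i, φ i x = 0) → x = 0) {r : ℕ}
    (M N : Matrix (Fin r) (Fin r) (LaurentSeries R))
    (h : ∀ i, M.map (lmap (φ i)) = N.map (lmap (φ i))) : M = N := by
  ext i j n
  rw [← sub_eq_zero]
  refine hinj _ fun k => ?_
  rw [map_sub, sub_eq_zero]
  exact congrArg (fun P => (P i j).coeff n) (h k)

theorem inv_cong {R : Type*} [CommRing R] (m : Ideal R) {r : ℕ}
    (b b' : Matrix (Fin r) (Fin r) (LaurentSeries R)) (hbb : b' * b = 1)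
    (hb : ∀ i j n, ((b - 1) i j).coeff n ∈ m) : ∀ i j n, ((b' - 1) i j).coeff n ∈ m := by
  intro i j n
  have e : b' - 1 = -(b' * (b - 1)) := by rw [mul_sub, hbb, mul_one]; abel
  rw [e, Matrix.neg_apply, HahnSeries.coeff_neg]
  exact neg_mem (mat_coeff_mul_mem m.toAddSubmonoid _ _ _ _ _ fun l c d _ =>
    Ideal.mul_mem_left _ _ (hb _ _ _))

theorem not_isField_quot {R : Type*} [CommRing R] [IsReduced R] [IsLocalRing R]
    (hm : IsLocalRing.maximalIdeal R ≠ ⊥) (P : Ideal R) (hP : P ∈ minimalPrimes R) :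
    ¬ IsField (R ⧸ P) := by
  intro hf
  have hmax : P.IsMaximal := Ideal.Quotient.maximal_of_isField P hf
  have hPm : P = IsLocalRing.maximalIdeal R := IsLocalRing.eq_maximalIdeal hmax
  apply hm
  rw [eq_bot_iff, ← Ideal.zero_eq_bot, ← nilradical_eq_zero R, nilradical_eq_sInf]
  refine le_sInf fun Q hQ => ?_
  have hQ' : Q.IsPrime := hQ
  have hQm : Q ≤ P := hPm ▸ IsLocalRing.le_maximalIdeal hQ'.ne_top
  have := hP.2 ⟨hQ', bot_le⟩ hQm
  rw [← hPm]; exact this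

theorem point_val {R : Type*} [CommRing R] [IsReduced R] [IsNoetherianRing R] [IsLocalRing R]
    (hm : IsLocalRing.maximalIdeal R ≠ ⊥) (𝔭 : PrimeSpectrum R)
    (hP : 𝔭.asIdeal ∈ minimalPrimes R) {q : ℕ} (hq : 2 ≤ q) :
    ∃ V : ValuationSubring (AlgebraicClosure (FractionRing (R ⧸ 𝔭.asIdeal))),
    ∃ a : AlgebraicClosure (FractionRing (R ⧸ 𝔭.asIdeal)), a ≠ 0 ∧ V.valuation a < 1 ∧
      (∀ d, V.valuation (ptHom 𝔭 d) ≤ 1) ∧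
      (∀ d ∈ IsLocalRing.maximalIdeal R, V.valuation (ptHom 𝔭 d) ≤ V.valuation a) ∧
      (∀ x, ∃ n : ℕ, V.valuation x * V.valuation a ^ n ≤ 1) ∧
      (∀ x, (∀ j : ℕ, V.valuation x ^ (q ^ j) * V.valuation a ≤ 1) → V.valuation x ≤ 1) := by
  have hnf := not_isField_quot hm 𝔭.asIdeal hP
  have := 𝔭.isPrime
  have : IsLocalRing (R ⧸ 𝔭.asIdeal) :=
    IsLocalRing.of_surjective' (Ideal.Quotient.mk 𝔭.asIdeal) Ideal.Quotient.mk_surjective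
  have : Algebra.IsAlgebraic (R ⧸ 𝔭.asIdeal)
      (AlgebraicClosure (FractionRing (R ⧸ 𝔭.asIdeal))) :=
    (IsFractionRing.comap_isAlgebraic_iff (A := R ⧸ 𝔭.asIdeal)
      (K := FractionRing (R ⧸ 𝔭.asIdeal))).2 inferInstance
  have hinj : Function.Injective (algebraMap (R ⧸ 𝔭.asIdeal)
      (AlgebraicClosure (FractionRing (R ⧸ 𝔭.asIdeal)))) := by
    rw [IsScalarTower.algebraMap_eq (R ⧸ 𝔭.asIdeal) (FractionRing (R ⧸ 𝔭.asIdeal))]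
    exact (RingHom.injective (algebraMap (FractionRing (R ⧸ 𝔭.asIdeal)) _)).comp
      (IsFractionRing.injective (R ⧸ 𝔭.asIdeal) (FractionRing (R ⧸ 𝔭.asIdeal)))
  have : FaithfulSMul (R ⧸ 𝔭.asIdeal) (AlgebraicClosure (FractionRing (R ⧸ 𝔭.asIdeal))) :=
    (faithfulSMul_iff_algebraMap_injective _ _).2 hinj
  obtain ⟨V, a, h0, h1, h2, h3, h4, h5⟩ := exists_val (D := R ⧸ 𝔭.asIdeal)
    (K := AlgebraicClosure (FractionRing (R ⧸ 𝔭.asIdeal))) hnf q hq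
  have e : ∀ d, ptHom 𝔭 d = algebraMap (R ⧸ 𝔭.asIdeal)
      (AlgebraicClosure (FractionRing (R ⧸ 𝔭.asIdeal))) (Ideal.Quotient.mk 𝔭.asIdeal d) := by
    intro d
    rw [IsScalarTower.algebraMap_apply (R ⧸ 𝔭.asIdeal) (FractionRing (R ⧸ 𝔭.asIdeal))
      (AlgebraicClosure (FractionRing (R ⧸ 𝔭.asIdeal)))]
    rfl
  refine ⟨V, a, h0, h1, fun d => ?_, fun d hd => ?_, h4, h5⟩
  · rw [e]; exact h2 _
  · rw [e]
    refine h3 _ ?_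
    rw [IsLocalRing.mem_maximalIdeal, mem_nonunits_iff]
    intro hu
    rw [isUnit_iff_exists_inv] at hu
    obtain ⟨w, hw⟩ := hu
    obtain ⟨w, rfl⟩ := Ideal.Quotient.mk_surjective w
    rw [← map_mul, ← map_one (Ideal.Quotient.mk 𝔭.asIdeal), Ideal.Quotient.eq] at hw
    have hle : 𝔭.asIdeal ≤ IsLocalRing.maximalIdeal R := IsLocalRing.le_maximalIdeal 𝔭.isPrime.ne_top
    have h6 := sub_mem (Ideal.mul_mem_right w _ hd) (hle hw)
    rw [sub_sub_cancel] at h6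
    exact (Ideal.ne_top_iff_one _).1 (IsLocalRing.maximalIdeal.isMaximal R).ne_top h6

theorem frobAdd_of_hom {p : ℕ} [Fact p.Prime] {e : ℕ} {B : Type*} [CommRing B] [Nontrivial B]
    (φ : GaloisField p e →+* B) : FrobAdd (p ^ e) B := by
  have : CharP B p := charP_of_injective_ringHom φ.injective p
  exact ⟨pow_ne_zero _ (Fact.out : p.Prime).ne_zero, fun x y => add_pow_char_pow x y p e⟩

theorem ptHom_inj {R : Type*} [CommRing R] [IsReduced R] (x : R)
    (hx : ∀ 𝔭 : {𝔭 : PrimeSpectrum R // 𝔭.asIdeal ∈ minimalPrimes R}, ptHom 𝔭.1 x = 0) :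
    x = 0 := by
  have h1 : x ∈ nilradical R := by
    rw [nilradical, ← Ideal.sInf_minimalPrimes]
    refine Ideal.mem_sInf.2 fun {P} hP => ?_
    have h2 := hx ⟨⟨P, hP.1.1⟩, hP⟩
    have : P.IsPrime := hP.1.1
    have h3 : Function.Injective ((algebraMap (FractionRing (R ⧸ P))
      (AlgebraicClosure (FractionRing (R ⧸ P)))).comp
        (algebraMap (R ⧸ P) (FractionRing (R ⧸ P)))) :=
      (RingHom.injective (algebraMap (FractionRing (R ⧸ P)) _)).comp
        (IsFractionRing.injective (R ⧸ P) (FractionRing (R ⧸ P)))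
    have h4 := (map_eq_zero_iff _ h3).1 h2
    exact Ideal.Quotient.eq_zero_iff_mem.1 h4
  rwa [nilradical_eq_zero R] at h1

/-- The Claim in the proof of **Proposition 7.1** for `G = GL_r`:  if `b ≡ 1 mod 𝔪` and at
every minimal prime `𝔭` of `R` the fibre `b_𝔭` is of the form `y·σ(y)⁻¹`, then `b` is
`σ`-conjugate to the identity over `R`, i.e. `b·σ(x) = x` for some `x ∈ GL_r(R((z)))`. -/
theorem sigma_trivialization
    {p : ℕ} [Fact p.Prime] {e : ℕ} (he : 1 ≤ e) {q : ℕ} (hq : q = p ^ e)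
    {R : Type*} [CommRing R] [Algebra (GaloisField p e) R]
    [IsReduced R] [IsNoetherianRing R] [IsLocalRing R]
    [IsAdicComplete (IsLocalRing.maximalIdeal R) R]
    {r : ℕ} (hr : 1 ≤ r)
    (b : Matrix (Fin r) (Fin r) (LaurentSeries R)) (hb : IsUnit b)
    (hcong : ∀ (i j : Fin r) (n : ℤ),
      ((b - 1) i j).coeff n ∈ IsLocalRing.maximalIdeal R)
    (hgen : ∀ 𝔭 : PrimeSpectrum R, 𝔭.asIdeal ∈ minimalPrimes R →
      ∃ y : Matrix (Fin r) (Fin r)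
          (LaurentSeries (AlgebraicClosure (FractionRing (R ⧸ 𝔭.asIdeal)))),
        IsUnit y ∧ b.map (lmap (ptHom 𝔭)) * matFrob q y = y) :
    ∃ x : Matrix (Fin r) (Fin r) (LaurentSeries R),
      IsUnit x ∧ b * matFrob q x = x := by
  have hp2 : 2 ≤ p := (Fact.out : p.Prime).two_le
  have hq2 : 2 ≤ q := by
    rw [hq]
    exact hp2.trans (Nat.le_self_pow (by omega) p)
  have hF : FrobAdd q R := hq ▸ frobAdd_of_hom (algebraMap (GaloisField p e) R)
  by_cases hm : IsLocalRing.maximalIdeal R = ⊥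
  · have hb1 : b = 1 := by
      rw [← sub_eq_zero]
      ext i j n
      have := hcong i j n
      rw [hm, Ideal.mem_bot] at this
      exact this
    refine ⟨1, isUnit_one, ?_⟩
    rw [hb1, matFrob_one hF, one_mul]
  obtain ⟨b', hbb⟩ := hb.exists_left_inv
  have hbb2 : b * b' = 1 := mul_eq_one_comm.1 hbb
  have hcong' := inv_cong _ b b' hbb hcong
  let I := {𝔭 : PrimeSpectrum R // 𝔭.asIdeal ∈ minimalPrimes R}
  have hfin : Finite I := by
    have := (minimalPrimes.finite_of_isNoetherianRing R).to_subtype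
    refine Finite.of_injective (fun k : I => (⟨k.1.asIdeal, k.2⟩ : minimalPrimes R)) ?_
    intro k l hkl
    exact Subtype.ext (PrimeSpectrum.ext (congrArg Subtype.val hkl))
  let K : I → Type _ := fun k => AlgebraicClosure (FractionRing (R ⧸ k.1.asIdeal))
  let φ : ∀ k : I, R →+* K k := fun k => ptHom k.1
  have hFK : ∀ k, FrobAdd q (K k) := fun k =>
    hq ▸ frobAdd_of_hom ((φ k).comp (algebraMap (GaloisField p e) R))
  have hinj : ∀ x, (∀ k, φ k x = 0) → x = 0 := fun x hx => ptHom_inj x hx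
  choose V a ha0 ha1 hd1 hdm hP2 hP3 using fun k : I => point_val hm k.1 k.2 hq2
  have hlt : ∀ (k : I) (M : Matrix (Fin r) (Fin r) (LaurentSeries R)),
      (∀ i j n, ((M - 1) i j).coeff n ∈ IsLocalRing.maximalIdeal R) →
      ∀ i j n, (V k).valuation (((M.map (lmap (φ k)) - 1) i j).coeff n) < 1 := by
    intro k M hM i j n
    rw [← map_lmap_one (φ k), ← map_lmap_sub]
    exact (hdm k _ (hM i j n)).trans_lt (ha1 k)
  have : Finite (GaloisField p e) := inferInstance
  let _ : Fintype (GaloisField p e) := Fintype.ofFinite _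
  have hcard : Fintype.card (GaloisField p e) = q := by
    rw [hq, ← GaloisField.card p e (by omega), Nat.card_eq_fintype_card]
  have hpt : ∀ k : I, ∃ y' f' : Matrix (Fin r) (Fin r) (LaurentSeries (K k)), y' * f' = 1 ∧
      b.map (lmap (φ k)) * matFrob q y' = y' ∧
      (∀ i j n, (V k).valuation (((y' - 1) i j).coeff n) < 1) ∧
      (∀ i j n, (V k).valuation (((f' - 1) i j).coeff n) < 1) := by
    intro k
    obtain ⟨y, hyu, hby⟩ := hgen k.1 k.2
    obtain ⟨f, hyf⟩ := hyu.exists_right_inv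
    exact point_norm (V k).valuation ((φ k).comp (algebraMap (GaloisField p e) R)) hcard hq2
      (hFK k) (a k) (ha0 k) (ha1 k) (hP2 k) (hP3 k) (b.map (lmap (φ k))) (b'.map (lmap (φ k)))
      y f (by rw [← map_lmap_mul, hbb, map_lmap_one]) hyf hby (hlt k b hcong) (hlt k b' hcong')
  choose y f hyf hby hy hf using hpt
  obtain ⟨X, hX⟩ := lift_sol (IsLocalRing.maximalIdeal R) hq2 hF K φ hFK hinj V a ha0 ha1 hd1 hdm
    hP2 hP3 b hcong y f hyf hby hy hf
  have htr : ∀ {B : Type _} [CommRing B] (M : Matrix (Fin r) (Fin r) (LaurentSeries B)),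
      M.transpose - 1 = (M - 1).transpose := fun M => by
    rw [Matrix.transpose_sub, Matrix.transpose_one]
  obtain ⟨Y, hY⟩ := lift_sol (IsLocalRing.maximalIdeal R) hq2 hF K φ hFK hinj V a ha0 ha1 hd1 hdm
    hP2 hP3 b'.transpose
    (fun i j n => by rw [htr]; exact hcong' j i n)
    (fun k => (f k).transpose) (fun k => (y k).transpose)
    (fun k => by rw [← Matrix.transpose_mul, hyf, Matrix.transpose_one])
    (fun k => by
      have hfy : f k * y k = 1 := mul_eq_one_comm.1 (hyf k)
      have hσyf : matFrob q (y k) * matFrob q (f k) = 1 := by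
        rw [← matFrob_mul (hFK k), hyf, matFrob_one (hFK k)]
      have hσf : matFrob q (f k) = f k * b.map (lmap (φ k)) := by
        calc matFrob q (f k) = f k * y k * matFrob q (f k) := by rw [hfy, one_mul]
          _ = f k * (b.map (lmap (φ k)) * matFrob q (y k)) * matFrob q (f k) := by rw [hby]
          _ = f k * b.map (lmap (φ k)) * (matFrob q (y k) * matFrob q (f k)) := by
            simp only [mul_assoc]
          _ = _ := by rw [hσyf, mul_one]
      change (b'.map (lmap (φ k))).transpose * (matFrob q (f k)).transpose = _
      rw [← Matrix.transpose_mul, hσf, mul_assoc, ← map_lmap_mul, hbb2, map_lmap_one, mul_one])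
    (fun k i j n => by rw [htr]; exact hf k j i n)
    (fun k i j n => by rw [htr]; exact hy k j i n)
  have hXY : X * Y.transpose = 1 := by
    refine mat_ext K φ hinj _ _ fun k => ?_
    have h1 : Y.transpose.map (lmap (φ k)) = f k := by
      have := congrArg Matrix.transpose (hY k)
      rw [Matrix.transpose_transpose] at this
      exact this
    rw [map_lmap_mul, hX, h1, hyf, map_lmap_one]
  refine ⟨X, IsUnit.of_mul_eq_one _ hXY, ?_⟩
  refine mat_ext K φ hinj _ _ fun k => ?_
  rw [map_lmap_mul, ← matFrob_lmap hF.1, hX, hby]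

end HVpaper
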